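/- arXiv:2511.07589 — 2 statements merged into one kernel-verified Lean document; each statement's English description precedes it below -/
import Mathlib

section
/- Let A be a commutative Noetherian ring, and let I ⊂ A be a local complete intersection ideal of height r ≥ 2 with dim(A/I) ≤ 1. Then there exists a local complete intersection ideal J ⊂ A of height r such that √I = √J and J/J² is a free A/J-module of rank r. -/
/-- The height of an ideal `I`: the infimum of the heights of the prime ideals
containing `I` (computed in the prime spectrum). -/
noncomputable def idealHeight {A : Type*} [CommRing A] (I : Ideal A) : ℕ∞ :=
  ⨅ (p : PrimeSpectrum A) (_ : I ≤ p.asIdeal), Order.height p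

/-- `I` is a local complete intersection ideal of height `n`: `I` has height `n`
and, for every prime ideal `P ⊇ I`, the ideal `I · A_P` of the localization `A_P`
is generated by a regular sequence of length `n`. -/
def IsLocalCompleteIntersectionOfHeight {A : Type*} [CommRing A] (I : Ideal A) (n : ℕ) : Prop :=
  idealHeight I = n ∧
  ∀ (P : Ideal A) [P.IsPrime], I ≤ P →
    ∃ rs : List (Localization.AtPrime P),
      rs.length = n ∧ RingTheory.Sequence.IsRegular (Localization.AtPrime P) rs ∧
      Ideal.ofList rs = I.map (algebraMap A (Localization.AtPrime P))

open RingTheory.Sequence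

section Reg
variable {R : Type*} [CommRing R]

lemma lci_weak_snoc (l : List R) (x : R) :
    IsWeaklyRegular R (l ++ [x]) ↔
      IsWeaklyRegular R l ∧ ∀ z, x * z ∈ Ideal.ofList l → z ∈ Ideal.ofList l := by
  rw [isWeaklyRegular_append_iff, isWeaklyRegular_singleton_iff]
  refine and_congr_right fun _ => ?_
  have hI : (Ideal.ofList l • ⊤ : Submodule R R) = Ideal.ofList l := by simp
  constructor
  · intro h z hz
    have := (isSMulRegular_iff_right_eq_zero_of_smul (M := R ⧸ (Ideal.ofList l • ⊤ : Submodule R R)) (r := x)).1 h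
      (Submodule.Quotient.mk z) (by
        rw [← Submodule.Quotient.mk_smul, Submodule.Quotient.mk_eq_zero, hI]
        simpa using hz)
    rw [Submodule.Quotient.mk_eq_zero, hI] at this
    exact this
  · intro h
    rw [isSMulRegular_iff_right_eq_zero_of_smul]
    intro m hm
    obtain ⟨z, rfl⟩ := Submodule.Quotient.mk_surjective _ m
    rw [← Submodule.Quotient.mk_smul, Submodule.Quotient.mk_eq_zero, hI] at hm
    rw [Submodule.Quotient.mk_eq_zero, hI]
    exact h z (by simpa using hm)

lemma lci_isRegular_iff' (l : List R) :
    IsRegular R l ↔ IsWeaklyRegular R l ∧ Ideal.ofList l ≠ ⊤ := by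
  rw [isRegular_iff]
  simp [ne_comm]

lemma lci_reg_snoc (l : List R) (x : R) (h : IsRegular R (l ++ [x])) :
    ∀ z, x * z ∈ Ideal.ofList l → z ∈ Ideal.ofList l :=
  ((lci_weak_snoc l x).1 ((lci_isRegular_iff' _).1 h).1).2

lemma lci_snoc_pow (l : List R) (x : R) (h : IsRegular R (l ++ [x])) :
    IsRegular R (l ++ [x ^ 2]) := by
  rw [lci_isRegular_iff', lci_weak_snoc] at *
  obtain ⟨⟨h1, h2⟩, h3⟩ := h
  refine ⟨⟨h1, fun z hz => ?_⟩, fun h => h3 ?_⟩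
  · apply h2; apply h2; convert hz using 1; ring
  · rw [eq_top_iff, ← h, Ideal.ofList_append, Ideal.ofList_append]
    refine sup_le_sup_left ?_ _
    rw [Ideal.ofList_singleton, Ideal.ofList_singleton, Ideal.span_singleton_le_span_singleton]
    exact dvd_pow_self x two_ne_zero

lemma lci_snoc_exch (l : List R) (x ρ t : R) (ht : IsUnit t) (hx : x - t * ρ ∈ Ideal.ofList l)
    (h : IsRegular R (l ++ [ρ])) :
    IsRegular R (l ++ [x]) ∧ Ideal.ofList (l ++ [x]) = Ideal.ofList (l ++ [ρ]) := by
  have hid : Ideal.ofList (l ++ [x]) = Ideal.ofList (l ++ [ρ]) := by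
    simp only [Ideal.ofList_append, Ideal.ofList_singleton]
    apply le_antisymm
    · refine sup_le le_sup_left ?_
      rw [Ideal.span_singleton_le_iff_mem]
      have : x = (x - t * ρ) + t * ρ := by ring
      rw [this]
      exact Ideal.add_mem _ (Ideal.mem_sup_left hx)
        (Ideal.mem_sup_right (Ideal.mul_mem_left _ _ (Ideal.mem_span_singleton_self _)))
    · refine sup_le le_sup_left ?_
      rw [Ideal.span_singleton_le_iff_mem]
      obtain ⟨u, rfl⟩ := ht
      have : ρ = (↑u⁻¹ : R) * x - (↑u⁻¹ : R) * (x - u * ρ) := by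
        have := u.inv_mul
        linear_combination -ρ * this
      rw [this]
      exact Ideal.sub_mem _ (Ideal.mem_sup_right (Ideal.mul_mem_left _ _ (Ideal.mem_span_singleton_self _)))
        (Ideal.mem_sup_left (Ideal.mul_mem_left _ _ hx))
  refine ⟨?_, hid⟩
  rw [lci_isRegular_iff'] at *
  rw [hid]
  refine ⟨?_, h.2⟩
  have h1 := h.1
  rw [lci_weak_snoc] at *
  refine ⟨h1.1, fun z hz => h1.2 z ?_⟩
  obtain ⟨u, rfl⟩ := ht
  have : ρ * z = (↑u⁻¹ : R) * (x * z) - (↑u⁻¹ : R) * z * (x - u * ρ) := by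
    have := u.inv_mul
    linear_combination -ρ * z * this
  rw [this]
  exact Ideal.sub_mem _ (Ideal.mul_mem_left _ _ hz) (Ideal.mul_mem_left _ _ hx)

lemma lci_ofList_ofFn {n : ℕ} (e : Fin n → R) :
    Ideal.ofList (List.ofFn e) = Ideal.span (Set.range e) := by
  unfold Ideal.ofList
  congr 1
  ext x
  simp [List.mem_ofFn]

/-- Relations among a weakly regular sequence have coefficients in the ideal. -/
lemma lci_rel {n : ℕ} (e : Fin n → R) (h : IsWeaklyRegular R (List.ofFn e)) (c : Fin n → R)
    (hc : ∑ i, c i * e i = 0) : ∀ i, c i ∈ Ideal.span (Set.range e) := by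
  induction n with
  | zero => exact fun i => i.elim0
  | succ n ih =>
    rw [List.ofFn_succ', List.concat_eq_append, lci_weak_snoc, lci_ofList_ofFn] at h
    obtain ⟨h1, h2⟩ := h
    rw [Fin.sum_univ_castSucc] at hc
    have hle : Ideal.span (Set.range fun i : Fin n => e i.castSucc) ≤ Ideal.span (Set.range e) := by
      apply Ideal.span_mono
      rintro _ ⟨i, rfl⟩
      exact ⟨_, rfl⟩
    have hl : c (Fin.last n) ∈ Ideal.span (Set.range fun i : Fin n => e i.castSucc) := by
      apply h2
      have : e (Fin.last n) * c (Fin.last n) = - ∑ i : Fin n, c i.castSucc * e i.castSucc := by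
        linear_combination hc
      rw [this]
      refine neg_mem (sum_mem fun i _ => Ideal.mul_mem_left _ _ (Ideal.subset_span ⟨i, rfl⟩))
    obtain ⟨d, hd⟩ := (Ideal.mem_span_range_iff_exists_fun).1 hl
    have := ih (fun i => e i.castSucc) h1 (fun i => c i.castSucc + d i * e (Fin.last n)) (by
      simp only [add_mul, Finset.sum_add_distrib]
      have h3 : ∑ i : Fin n, d i * e (Fin.last n) * e i.castSucc = c (Fin.last n) * e (Fin.last n) := by
        rw [← hd, Finset.sum_mul]
        exact Finset.sum_congr rfl fun i _ => by ring
      rw [h3, hc])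
    intro i
    refine Fin.lastCases (hle hl) (fun i => ?_) i
    have h4 := hle (this i)
    have : c i.castSucc = (c i.castSucc + d i * e (Fin.last n)) - d i * e (Fin.last n) := by ring
    rw [this]
    exact Ideal.sub_mem _ h4 (Ideal.mul_mem_left _ _ (Ideal.subset_span ⟨_, rfl⟩))

lemma lci_basis {n : ℕ} (K : Ideal R) (e : Fin n → R) (he : ∀ i, e i ∈ K)
    (hspan : K ≤ Ideal.span (Set.range e) ⊔ K ^ 2)
    (hind : ∀ c : Fin n → R, ∑ i, c i * e i ∈ K ^ 2 → ∀ i, c i ∈ K) :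
    Nonempty (Module.Basis (Fin n) (R ⧸ K) K.Cotangent) := by
  let b : Fin n → K.Cotangent := fun i => K.toCotangent ⟨e i, he i⟩
  have key : ∀ c : Fin n → R, ∑ i, Ideal.Quotient.mk K (c i) • b i =
      K.toCotangent ⟨∑ i, c i * e i, sum_mem fun i _ => K.mul_mem_left _ (he i)⟩ := by
    intro c
    have : (⟨∑ i, c i * e i, sum_mem fun i _ => K.mul_mem_left _ (he i)⟩ : K) =
        ∑ i, c i • (⟨e i, he i⟩ : K) := by
      ext; simp
    rw [this, map_sum]
    refine Finset.sum_congr rfl fun i _ => ?_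
    rw [map_smul]
    rfl
  refine ⟨Module.Basis.mk (v := b) ?_ ?_⟩
  · rw [Fintype.linearIndependent_iff]
    intro g hg i
    choose c hc using fun i => Ideal.Quotient.mk_surjective (g i)
    have hg' : ∑ i, Ideal.Quotient.mk K (c i) • b i = 0 := by
      rw [← hg]; exact Finset.sum_congr rfl fun i _ => by rw [hc]
    rw [key, Ideal.toCotangent_eq_zero] at hg'
    rw [← hc, Ideal.Quotient.eq_zero_iff_mem]
    exact hind c hg' i
  · intro z _
    obtain ⟨⟨z, hz⟩, rfl⟩ := K.toCotangent_surjective z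
    obtain ⟨u, hu, v, hv, rfl⟩ := Submodule.mem_sup.1 (hspan hz)
    obtain ⟨c, rfl⟩ := (Ideal.mem_span_range_iff_exists_fun).1 hu
    have : K.toCotangent ⟨∑ i, c i * e i + v, hz⟩ = ∑ i, Ideal.Quotient.mk K (c i) • b i := by
      rw [key, Ideal.toCotangent_eq]
      simpa using hv
    rw [this]
    exact Submodule.sum_mem _ fun i _ => Submodule.smul_mem _ _ (Submodule.subset_span ⟨i, rfl⟩)

lemma lci_reg_ind {n : ℕ} (e : Fin n → R) (h : IsRegular R (List.ofFn e)) (c : Fin n → R)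
    (hc : ∑ i, c i * e i ∈ (Ideal.span (Set.range e)) ^ 2) : ∀ i, c i ∈ Ideal.span (Set.range e) := by
  rw [pow_two] at hc
  have : ∃ d : Fin n → R, (∀ i, d i ∈ Ideal.span (Set.range e)) ∧ ∑ i, c i * e i = ∑ i, d i * e i := by
    have := (Submodule.mem_ideal_smul_span_iff_exists_sum (Ideal.span (Set.range e)) e (∑ i, c i * e i)).1 hc
    obtain ⟨a, ha, h⟩ := this
    refine ⟨a, ha, ?_⟩
    rw [← h, Finsupp.sum_fintype]
    · rfl
    · simp
  obtain ⟨d, hd, hcd⟩ := this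
  intro i
  have := lci_rel e h.1 (fun i => c i - d i) (by simp [sub_mul, Finset.sum_sub_distrib, hcd]) i
  have h2 : c i = (c i - d i) + d i := by ring
  rw [h2]
  exact add_mem this (hd i)

lemma lci_min_gens (rs xs : List R) (h : IsRegular R rs) (hid : Ideal.ofList xs = Ideal.ofList rs) :
    rs.length ≤ xs.length := by
  set K := Ideal.ofList rs with hK
  have hKe : K = Ideal.span (Set.range rs.get) := by
    rw [hK, ← lci_ofList_ofFn]; simp
  have hreg : IsRegular R (List.ofFn rs.get) := by simpa using h
  have hne : K ≠ ⊤ := ((lci_isRegular_iff' _).1 h).2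
  have : Nontrivial (R ⧸ K) := Ideal.Quotient.nontrivial_iff.2 hne
  obtain ⟨b⟩ := lci_basis K rs.get (fun i => by rw [hKe]; exact Ideal.subset_span ⟨i, rfl⟩)
    (by rw [← hKe]; exact le_sup_left)
    (by rw [hKe]; exact lci_reg_ind _ hreg)
  have hxK : K = Ideal.span (Set.range xs.get) := by
    rw [← hid, ← lci_ofList_ofFn]; simp
  have hx : ∀ i, xs.get i ∈ K := fun i => by rw [hxK]; exact Ideal.subset_span ⟨i, rfl⟩
  let w : Fin xs.length → K.Cotangent := fun i => K.toCotangent ⟨xs.get i, hx i⟩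
  have hw : ⊤ ≤ Submodule.span (R ⧸ K) (Set.range w) := by
    intro z _
    obtain ⟨⟨z, hz⟩, rfl⟩ := K.toCotangent_surjective z
    have hz' := hz
    rw [hxK] at hz'
    obtain ⟨c, rfl⟩ := (Ideal.mem_span_range_iff_exists_fun).1 hz'
    have : (⟨∑ i, c i * xs.get i, hz⟩ : K) = ∑ i, c i • (⟨xs.get i, hx i⟩ : K) := by
      ext; simp
    rw [this, map_sum]
    refine Submodule.sum_mem _ fun i _ => ?_
    rw [map_smul]
    have hmem : w i ∈ Submodule.span (R ⧸ K) (Set.range w) :=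
      Submodule.subset_span (Set.mem_range_self i)
    exact Submodule.smul_mem _ (Ideal.Quotient.mk K (c i)) hmem
  have h1 := Module.finrank_eq_card_basis b
  have h2 := finrank_range_le_card (R := R ⧸ K) w
  unfold Set.finrank at h2
  rw [top_le_iff.1 hw, finrank_top, h1] at h2
  simpa using h2

lemma lci_ofList_perm {l l' : List R} (h : l.Perm l') : Ideal.ofList l = Ideal.ofList l' := by
  unfold Ideal.ofList
  congr 1
  ext x
  exact h.mem_iff

end Reg

section Loc
variable {R : Type*} [CommRing R] [IsNoetherianRing R] [IsLocalRing R]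
open IsLocalRing

lemma lci_split (u rs : List R) (x : R) (hx : x ∈ Ideal.ofList (u ++ rs)) :
    (∃ ρ rs' t, IsUnit t ∧ rs.Perm (ρ :: rs') ∧ x - t * ρ ∈ Ideal.ofList (u ++ rs')) ∨
      x ∈ Ideal.ofList u ⊔ maximalIdeal R * Ideal.ofList rs := by
  induction rs generalizing x with
  | nil => right; simpa using hx
  | cons ρ rs1 ih =>
    have hx2 : x ∈ Ideal.span {ρ} ⊔ Ideal.ofList (u ++ rs1) := by
      rw [lci_ofList_perm List.perm_middle, Ideal.ofList_cons] at hx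
      exact hx
    obtain ⟨a, ha, x1, hx1, rfl⟩ := Submodule.mem_sup.1 hx2
    obtain ⟨t, rfl⟩ := Ideal.mem_span_singleton'.1 ha
    by_cases ht : IsUnit t
    · left
      exact ⟨ρ, rs1, t, ht, List.Perm.refl _, by simpa using hx1⟩
    · have htm : t ∈ maximalIdeal R := ht
      rcases ih x1 hx1 with ⟨ρ', rs', t', ht', hp, hm⟩ | h
      · left
        refine ⟨ρ', ρ :: rs', t', ht', (hp.cons ρ).trans (List.Perm.swap _ _ _), ?_⟩
        rw [lci_ofList_perm List.perm_middle, Ideal.ofList_cons]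
        have : t * ρ + x1 - t' * ρ' = t * ρ + (x1 - t' * ρ') := by ring
        rw [this]
        exact add_mem (Ideal.mem_sup_left ha) (Ideal.mem_sup_right hm)
      · right
        refine add_mem (Ideal.mem_sup_right ?_) ?_
        · exact Ideal.mul_mem_mul htm (Ideal.subset_span (by simp))
        · have hle : Ideal.ofList u ⊔ maximalIdeal R * Ideal.ofList rs1 ≤
              Ideal.ofList u ⊔ maximalIdeal R * Ideal.ofList (ρ :: rs1) := by
            refine sup_le_sup_left (Ideal.mul_mono_right ?_) _
            rw [Ideal.ofList_cons]; exact le_sup_right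
          exact hle h

lemma lci_exchange (xs : List R) : ∀ (u rs : List R), IsRegular R (u ++ rs) →
    Ideal.ofList (u ++ xs) = Ideal.ofList (u ++ rs) → xs.length = rs.length →
    IsRegular R (u ++ xs) := by
  induction xs with
  | nil =>
    intro u rs h _ hl
    have : rs = [] := by simpa using hl.symm
    subst this; exact h
  | cons x xs' ih =>
    intro u rs h hid hl
    have hx : x ∈ Ideal.ofList (u ++ rs) := by
      rw [← hid]; exact Ideal.subset_span (by simp)
    rcases lci_split u rs x hx with ⟨ρ, rs', t, ht, hp, hm⟩ | hbad
    · have hp1 : (u ++ rs).Perm ((u ++ rs') ++ [ρ]) := by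
        refine (hp.append_left u).trans ?_
        refine List.perm_middle.trans ?_
        exact (List.perm_append_singleton ρ (u ++ rs')).symm
      have h1 := isRegular_of_perm h hp1
      obtain ⟨h2, h3⟩ := lci_snoc_exch _ x ρ t ht hm h1
      have hp2 : ((u ++ rs') ++ [x]).Perm ((u ++ [x]) ++ rs') := by
        simp only [List.append_assoc]
        exact List.perm_append_comm.append_left u
      have h4 := isRegular_of_perm h2 hp2
      have := ih (u ++ [x]) rs' h4 (by
        rw [← lci_ofList_perm hp2, h3, ← lci_ofList_perm hp1, ← hid]; simp) (by
        have := hp.length_eq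
        simp at this hl; omega)
      simpa using this
    · exfalso
      have hgen : Ideal.ofList (u ++ xs') = Ideal.ofList (u ++ rs) := by
        have hle : Ideal.ofList (u ++ xs') ≤ Ideal.ofList (u ++ rs) := by
          rw [← hid]; simp only [Ideal.ofList_append, Ideal.ofList_cons]
          exact sup_le_sup_left le_sup_right _
        refine le_antisymm hle ?_
        refine Submodule.le_of_le_smul_of_le_jacobson_bot (I := maximalIdeal R)
          (IsNoetherian.noetherian _) (maximalIdeal_le_jacobson _) ?_
        have : Ideal.ofList (u ++ rs) = Ideal.span {x} ⊔ Ideal.ofList (u ++ xs') := by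
          rw [← hid, lci_ofList_perm List.perm_middle, Ideal.ofList_cons]
        conv_lhs => rw [this]
        refine sup_le ?_ le_sup_left
        rw [Ideal.span_singleton_le_iff_mem]
        have hle2 : Ideal.ofList u ⊔ maximalIdeal R * Ideal.ofList rs ≤
            Ideal.ofList (u ++ xs') ⊔ maximalIdeal R • Ideal.ofList (u ++ rs) := ?_
        · exact hle2 hbad
        refine sup_le_sup ?_ ?_
        · rw [Ideal.ofList_append]; exact le_sup_left
        · rw [smul_eq_mul]; refine Ideal.mul_mono_right ?_
          rw [Ideal.ofList_append]; exact le_sup_right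
      have := lci_min_gens _ _ h hgen
      simp at this hl; omega

/-- Any system of `n` generators of an ideal generated by a regular sequence of length `n`
in a Noetherian local ring is regular. -/
lemma lci_regular_of_gens (rs xs : List R) (h : IsRegular R rs)
    (hid : Ideal.ofList xs = Ideal.ofList rs) (hl : xs.length = rs.length) : IsRegular R xs := by
  simpa using lci_exchange xs [] rs (by simpa using h) (by simpa using hid) hl

end Loc


section Gen
variable {B E : Type*} [CommRing B] [AddCommGroup E] [Module B E]

/-- `E / N` is generated by `n` elements at `P`. -/
def LciLG (P : Ideal B) (n : ℕ) (N : Submodule B E) : Prop :=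
  ∃ e : Fin n → E, ∀ z : E, ∃ s, s ∉ P ∧ s • z ∈ N ⊔ Submodule.span B (Set.range e)

lemma lci_unif [Module.Finite B E] (P : Ideal B) [hP : P.IsPrime] (N : Submodule B E)
    (h : ∀ z : E, ∃ s, s ∉ P ∧ s • z ∈ N) : ∃ s, s ∉ P ∧ ∀ z : E, s • z ∈ N := by
  have key : ∀ X : Submodule B E, X.FG → ∃ s, s ∉ P ∧ ∀ z ∈ X, s • z ∈ N := by
    intro X hX
    refine Submodule.fg_induction (motive := fun X _ => ∃ s, s ∉ P ∧ ∀ z ∈ X, s • z ∈ N) ?_ ?_ X hX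
    · intro x
      obtain ⟨s, hs, hx⟩ := h x
      refine ⟨s, hs, fun z hz => ?_⟩
      obtain ⟨t, rfl⟩ := Submodule.mem_span_singleton.1 hz
      rw [smul_comm]
      exact N.smul_mem _ hx
    · rintro X Y _ _ ⟨s, hs, hX⟩ ⟨t, ht, hY⟩
      refine ⟨s * t, fun h => (hP.mem_or_mem h).elim hs ht, fun z hz => ?_⟩
      obtain ⟨a, ha, b, hb, rfl⟩ := Submodule.mem_sup.1 hz
      rw [smul_add]
      refine add_mem ?_ ?_
      · rw [mul_comm, mul_smul]; exact N.smul_mem _ (hX a ha)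
      · rw [mul_smul]; exact N.smul_mem _ (hY b hb)
  obtain ⟨s, hs, h⟩ := key ⊤ Module.Finite.fg_top
  exact ⟨s, hs, fun z => h z trivial⟩

lemma lci_open [Module.Finite B E] (P : Ideal B) [hP : P.IsPrime] (n : ℕ) (N : Submodule B E)
    (h : LciLG P n N) : ∃ s, s ∉ P ∧ ∀ P' : Ideal B, s ∉ P' → LciLG P' n N := by
  obtain ⟨e, he⟩ := h
  obtain ⟨s, hs, h⟩ := lci_unif P _ he
  exact ⟨s, hs, fun P' hP' => ⟨e, fun z => ⟨s, hP', h z⟩⟩⟩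

lemma lci_nak [Module.Finite B E] (P : Ideal B) [hP : P.IsPrime] (N : Submodule B E)
    (h : ∀ z : E, ∃ s, s ∉ P ∧ s • z ∈ N ⊔ P • (⊤ : Submodule B E)) :
    ∀ z : E, ∃ s, s ∉ P ∧ s • z ∈ N := by
  obtain ⟨s, hs, h⟩ := lci_unif P _ h
  let φ : (E ⧸ N) →ₗ[B] (E ⧸ N) := s • LinearMap.id
  have hφ : LinearMap.range φ ≤ P • (⊤ : Submodule B (E ⧸ N)) := by
    rintro _ ⟨z, rfl⟩
    obtain ⟨z, rfl⟩ := N.mkQ_surjective z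
    have h1 : φ (N.mkQ z) = N.mkQ (s • z) := by simp [φ]
    rw [h1]
    have h2 := Submodule.mem_map_of_mem (f := N.mkQ) (h z)
    rw [Submodule.map_sup, Submodule.map_smul''] at h2
    simpa using h2
  obtain ⟨p, hp, -, hc, hp0⟩ :=
    LinearMap.exists_monic_and_natDegree_eq_and_coeff_mem_pow_and_aeval_eq_zero B φ P hφ
  have hev : ∀ q : Polynomial B, ∀ z : E ⧸ N, (Polynomial.aeval φ q) z = q.eval s • z := by
    intro q z
    induction q using Polynomial.induction_on' with
    | add a b ha hb => simp [ha, hb, add_smul]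
    | monomial n a =>
      rw [Polynomial.aeval_monomial, Polynomial.eval_monomial, Module.End.mul_apply,
        Module.algebraMap_end_apply]
      have : ∀ z : E ⧸ N, (φ ^ n) z = s ^ n • z := by
        intro z
        induction n with
        | zero => simp
        | succ n ih =>
          rw [pow_succ', Module.End.mul_apply, ih, pow_succ', mul_smul]
          simp only [φ, LinearMap.smul_apply, LinearMap.id_apply]
      rw [this, mul_smul]
  have hq : p.eval s ∉ P := by
    intro hmem
    have h1 : p.eval s = s ^ p.natDegree + ∑ i ∈ Finset.range p.natDegree, p.coeff i * s ^ i := by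
      conv_lhs => rw [Polynomial.eval_eq_sum_range, Finset.sum_range_succ]
      rw [hp.coeff_natDegree, one_mul, add_comm]
    have h2 : ∑ i ∈ Finset.range p.natDegree, p.coeff i * s ^ i ∈ P := by
      refine sum_mem fun i hi => P.mul_mem_right _ ?_
      have := hc i
      exact Ideal.pow_le_self (by have := Finset.mem_range.1 hi; omega) this
    rw [h1] at hmem
    exact hs (hP.mem_of_pow_mem _ ((Ideal.add_mem_iff_left _ h2).1 hmem))
  intro z
  refine ⟨p.eval s, hq, ?_⟩
  have := hev p (N.mkQ z)
  rw [hp0] at this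
  rw [← Submodule.Quotient.mk_eq_zero, Submodule.Quotient.mk_smul]
  simpa using this.symm

lemma LciLG.mono {P : Ideal B} {n : ℕ} {N N' : Submodule B E} (h : LciLG P n N) (hN : N ≤ N') :
    LciLG P n N' := by
  obtain ⟨e, he⟩ := h
  refine ⟨e, fun z => ?_⟩
  obtain ⟨s, hs, hz⟩ := he z
  exact ⟨s, hs, (sup_le_sup_right hN _ : _ ≤ N' ⊔ _) hz⟩

lemma lci_LG_of_all {P : Ideal B} {N : Submodule B E} (n : ℕ)
    (h : ∀ z : E, ∃ s, s ∉ P ∧ s • z ∈ N) : LciLG P n N := by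
  refine ⟨fun _ => 0, fun z => ?_⟩
  obtain ⟨s, hs, hz⟩ := h z
  exact ⟨s, hs, Submodule.mem_sup_left hz⟩

lemma lci_LG_zero {P : Ideal B} {N : Submodule B E} (h : LciLG P 0 N) :
    ∀ z : E, ∃ s, s ∉ P ∧ s • z ∈ N := by
  obtain ⟨e, he⟩ := h
  simpa using he

lemma lci_dich (P : Ideal B) [hP : P.IsPrime] (n : ℕ) (N : Submodule B E) (a : E)
    (h : LciLG P (n + 1) N) : LciLG P n (N ⊔ Submodule.span B {a}) ∨
      ∃ s, s ∉ P ∧ s • a ∈ N ⊔ P • (⊤ : Submodule B E) := by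
  obtain ⟨e, he⟩ := h
  obtain ⟨s, hs, ha⟩ := he a
  obtain ⟨ν, hν, w, hw, hsum⟩ := Submodule.mem_sup.1 ha
  obtain ⟨t, rfl⟩ := (Submodule.mem_span_range_iff_exists_fun B).1 hw
  by_cases hall : ∀ i, t i ∈ P
  · right
    refine ⟨s, hs, ?_⟩
    rw [← hsum]
    refine add_mem (Submodule.mem_sup_left hν) (Submodule.mem_sup_right ?_)
    exact sum_mem fun i _ => Submodule.smul_mem_smul (hall i) trivial
  · left
    push Not at hall
    obtain ⟨i, hi⟩ := hall
    refine ⟨fun j => e (i.succAbove j), fun z => ?_⟩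
    set X := N ⊔ Submodule.span B {a} ⊔ Submodule.span B (Set.range fun j => e (i.succAbove j))
      with hX
    have hj : ∀ j, e (i.succAbove j) ∈ X := fun j =>
      Submodule.mem_sup_right (Submodule.subset_span ⟨j, rfl⟩)
    have hNX : N ≤ X := le_sup_left.trans le_sup_left
    have haX : a ∈ X := Submodule.mem_sup_left (Submodule.mem_sup_right
      (Submodule.mem_span_singleton_self a))
    have hti : t i • e i ∈ X := by
      rw [Fin.sum_univ_succAbove _ i] at hsum
      have : t i • e i = s • a - ν - ∑ j, t (i.succAbove j) • e (i.succAbove j) := by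
        rw [← hsum]; abel
      rw [this]
      exact sub_mem (sub_mem (X.smul_mem _ haX) (hNX hν)) (sum_mem fun j _ => X.smul_mem _ (hj j))
    obtain ⟨s', hs', hz⟩ := he z
    refine ⟨t i * s', fun h => (hP.mem_or_mem h).elim hi hs', ?_⟩
    obtain ⟨ν', hν', w', hw', hsum'⟩ := Submodule.mem_sup.1 hz
    obtain ⟨t', rfl⟩ := (Submodule.mem_span_range_iff_exists_fun B).1 hw'
    rw [mul_smul, ← hsum', Fin.sum_univ_succAbove _ i, smul_add, smul_add]
    refine add_mem (X.smul_mem _ (hNX hν')) (add_mem ?_ (X.smul_mem _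
      (sum_mem fun j _ => X.smul_mem _ (hj j))))
    rw [smul_comm]
    exact X.smul_mem _ hti

lemma lci_perturb [Module.Finite B E] (P : Ideal B) [hP : P.IsPrime] (n : ℕ) (N : Submodule B E)
    (b b' : E) (h : LciLG P n (N ⊔ Submodule.span B {b}))
    (hb : ∃ s, s ∉ P ∧ s • b ∈ N ⊔ Submodule.span B {b'} ⊔ P • (⊤ : Submodule B E)) :
    LciLG P n (N ⊔ Submodule.span B {b'}) := by
  obtain ⟨e, he⟩ := h
  obtain ⟨s, hs, hb⟩ := hb
  refine ⟨e, lci_nak P _ fun z => ?_⟩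
  obtain ⟨t, ht, hz⟩ := he z
  refine ⟨s * t, fun h => (hP.mem_or_mem h).elim hs ht, ?_⟩
  obtain ⟨w, hw, v, hv, hsum⟩ := Submodule.mem_sup.1 hz
  obtain ⟨ν, hν, u, hu, rfl⟩ := Submodule.mem_sup.1 hw
  obtain ⟨c, rfl⟩ := Submodule.mem_span_singleton.1 hu
  rw [mul_smul, ← hsum, smul_add, smul_add]
  have h1 : N ⊔ Submodule.span B {b'} ⊔ P • (⊤ : Submodule B E) ≤
      N ⊔ Submodule.span B {b'} ⊔ Submodule.span B (Set.range e) ⊔ P • (⊤ : Submodule B E) :=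
    sup_le_sup_right le_sup_left _
  refine add_mem (add_mem ?_ ?_) ?_
  · exact Submodule.smul_mem _ _ (h1 (Submodule.mem_sup_left (Submodule.mem_sup_left hν)))
  · rw [smul_comm]
    exact Submodule.smul_mem _ _ (h1 hb)
  · exact Submodule.smul_mem _ _ (Submodule.mem_sup_left (Submodule.mem_sup_right hv))

lemma lci_avoid [Module.Finite B E] (n : PrimeSpectrum B → ℕ)
    (N : PrimeSpectrum B → Submodule B E) :
    ∀ (k : ℕ) (S : Finset (PrimeSpectrum B)), S.card = k →
    (∀ P ∈ S, LciLG P.asIdeal (n P + 1) (N P)) →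
    ∃ a : E, ∀ P ∈ S, LciLG P.asIdeal (n P) (N P ⊔ Submodule.span B {a}) := by
  classical
  intro k
  induction k with
  | zero =>
    intro S hS _
    rw [Finset.card_eq_zero] at hS
    subst hS
    exact ⟨0, by simp⟩
  | succ k ih =>
    intro S hS hLG
    have hne : S.Nonempty := Finset.card_pos.1 (by omega)
    obtain ⟨P, hPmin⟩ := S.exists_minimal hne
    have hPS : P ∈ S := hPmin.1
    obtain ⟨a, ha⟩ := ih (S.erase P) (by rw [Finset.card_erase_of_mem hPS]; omega)
      (fun Q hQ => hLG Q (Finset.mem_of_mem_erase hQ))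
    by_cases hP : LciLG P.asIdeal (n P) (N P ⊔ Submodule.span B {a})
    · refine ⟨a, fun Q hQ => ?_⟩
      by_cases hQP : Q = P
      · subst hQP; exact hP
      · exact ha Q (Finset.mem_erase.2 ⟨hQP, hQ⟩)
    have haZ := (lci_dich P.asIdeal (n P) (N P) a (hLG P hPS)).resolve_left hP
    have hw : ∃ w : E, ¬ ∃ s, s ∉ P.asIdeal ∧
        s • w ∈ N P ⊔ P.asIdeal • (⊤ : Submodule B E) := by
      by_contra hcon
      push Not at hcon
      exact hP ((lci_LG_of_all (n P) (lci_nak P.asIdeal _ hcon)).mono le_sup_left)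
    obtain ⟨w, hw⟩ := hw
    have hy : ∃ y, y ∈ ∏ Q ∈ S.erase P, Q.asIdeal ∧ y ∉ P.asIdeal := by
      by_contra hcon
      push Not at hcon
      obtain ⟨Q, hQ, hle⟩ := (Ideal.IsPrime.prod_le P.isPrime).1
        (show ∏ Q ∈ S.erase P, Q.asIdeal ≤ P.asIdeal from hcon)
      have := hPmin.2 (Finset.mem_of_mem_erase hQ) hle
      exact (Finset.ne_of_mem_erase hQ) (le_antisymm hle this)
    obtain ⟨y, hy, hyP⟩ := hy
    refine ⟨a + y • w, fun Q hQ => ?_⟩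
    by_cases hQP : Q = P
    · subst hQP
      refine (lci_dich Q.asIdeal (n Q) (N Q) (a + y • w) (hLG Q hPS)).resolve_right ?_
      rintro ⟨s, hs, hmem⟩
      obtain ⟨t, ht, hta⟩ := haZ
      apply hw
      refine ⟨s * t * y, fun h => (Q.isPrime.mem_or_mem h).elim
        (fun h => (Q.isPrime.mem_or_mem h).elim hs ht) hyP, ?_⟩
      have : (s * t * y) • w = t • (s • (a + y • w)) - s • (t • a) := by
        simp only [smul_add, mul_smul]
        rw [smul_comm t s a, smul_comm t s]
        abel
      rw [this]
      exact sub_mem (Submodule.smul_mem _ _ hmem) (Submodule.smul_mem _ _ hta)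
    · have hQ' : Q ∈ S.erase P := Finset.mem_erase.2 ⟨hQP, hQ⟩
      refine lci_perturb Q.asIdeal (n Q) (N Q) a _ (ha Q hQ') ⟨1, Q.asIdeal.one_notMem, ?_⟩
      have hyQ : y ∈ Q.asIdeal := (Ideal.prod_le_inf.trans (Finset.inf_le hQ')) hy
      have : (1 : B) • a = (a + y • w) + (-y) • w := by simp
      rw [this]
      refine add_mem (Submodule.mem_sup_left (Submodule.mem_sup_right
        (Submodule.mem_span_singleton_self _))) (Submodule.mem_sup_right ?_)
      exact Submodule.smul_mem_smul (neg_mem hyQ) trivial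

lemma lci_fin [IsNoetherianRing B] (hdim : ringKrullDim B ≤ 1) (p : PrimeSpectrum B → Prop)
    (hop : ∀ P, p P → ∃ s, s ∉ P.asIdeal ∧ ∀ P' : PrimeSpectrum B, s ∉ P'.asIdeal → p P')
    (hmin : ∀ P : PrimeSpectrum B, P.asIdeal ∈ minimalPrimes B → p P) :
    {P | ¬ p P}.Finite ∧ ∀ P, ¬ p P → P.asIdeal.IsMaximal := by
  have hmax : ∀ P, ¬ p P → P.asIdeal.IsMaximal := by
    intro P hP
    by_contra hnm
    obtain ⟨m, hm, hPm⟩ := Ideal.exists_le_maximal P.asIdeal P.isPrime.ne_top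
    obtain ⟨p0, hp0, hp0P⟩ := Ideal.exists_minimalPrimes_le (I := ⊥) (J := P.asIdeal) bot_le
    have hp0' : p0.IsPrime := hp0.1.1
    let P0 : PrimeSpectrum B := ⟨p0, hp0'⟩
    let M : PrimeSpectrum B := ⟨m, hm.isPrime⟩
    have h1 : P0 < P := by
      refine lt_of_le_of_ne hp0P ?_
      intro h
      exact hP (hmin P (by rw [← h]; exact hp0))
    have h2 : P < M := by
      refine lt_of_le_of_ne hPm ?_
      intro h
      exact hnm (by rw [h]; exact hm)
    let c : LTSeries (PrimeSpectrum B) :=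
      { length := 2
        toFun := ![P0, P, M]
        step := by
          intro i
          fin_cases i
          · exact h1
          · exact h2 }
    have := (Order.LTSeries.length_le_krullDim c).trans hdim
    have hc : c.length = 2 := rfl
    rw [hc] at this
    exact absurd this (by norm_num)
  refine ⟨?_, hmax⟩
  let K : Ideal B := Ideal.span {s | ∀ P' : PrimeSpectrum B, s ∉ P'.asIdeal → p P'}
  have hK : ∀ P : PrimeSpectrum B, ¬ p P ↔ K ≤ P.asIdeal := by
    intro P
    constructor
    · intro hP
      rw [Ideal.span_le]
      intro s hs
      by_contra h
      exact hP (hs P h)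
    · intro hle hP
      obtain ⟨s, hs, h⟩ := hop P hP
      exact hs (hle (Ideal.subset_span h))
  have hfin := Ideal.finite_minimalPrimes_of_isNoetherianRing B K
  refine Set.Finite.of_finite_image (f := PrimeSpectrum.asIdeal) (hfin.subset ?_) ?_
  · rintro _ ⟨P, hP, rfl⟩
    refine ⟨⟨P.isPrime, (hK P).1 hP⟩, ?_⟩
    rintro Q ⟨hQ, hKQ⟩ hQP
    have := hmax ⟨Q, hQ⟩ ((hK ⟨Q, hQ⟩).2 hKQ)
    exact (this.eq_of_le P.isPrime.ne_top hQP).ge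
  · intro P _ Q _ h
    exact PrimeSpectrum.ext h

variable [IsNoetherianRing B] [Module.Finite B E]

lemma lci_finite_min : {P : PrimeSpectrum B | P.asIdeal ∈ minimalPrimes B}.Finite := by
  refine Set.Finite.of_finite_image (f := PrimeSpectrum.asIdeal)
    ((minimalPrimes.finite_of_isNoetherianRing B).subset ?_) ?_
  · rintro _ ⟨P, hP, rfl⟩; exact hP
  · intro P _ Q _ h
    exact PrimeSpectrum.ext h

lemma lci_fin' (hdim : ringKrullDim B ≤ 1) (n : ℕ) (N : Submodule B E)
    (hmin : ∀ P : PrimeSpectrum B, P.asIdeal ∈ minimalPrimes B → LciLG P.asIdeal n N) :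
    {P : PrimeSpectrum B | ¬ LciLG P.asIdeal n N}.Finite ∧
      ∀ P : PrimeSpectrum B, ¬ LciLG P.asIdeal n N → P.asIdeal.IsMaximal := by
  refine lci_fin hdim (fun P => LciLG P.asIdeal n N) (fun P hP => ?_) hmin
  obtain ⟨s, hs, h⟩ := lci_open P.asIdeal n N hP
  exact ⟨s, hs, fun P' => h P'.asIdeal⟩

lemma lci_step (hdim : ringKrullDim B ≤ 1) (n : ℕ) (N : Submodule B E)
    (h : ∀ P : PrimeSpectrum B, LciLG P.asIdeal (n + 2) N) :
    ∃ a : E, ∀ P : PrimeSpectrum B, LciLG P.asIdeal (n + 1) (N ⊔ Submodule.span B {a}) := by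
  classical
  obtain ⟨a, ha⟩ := lci_avoid (fun _ => n + 1) (fun _ => N) _ (lci_finite_min (B := B)).toFinset rfl
    (fun P _ => h P)
  obtain ⟨hV1, hV1m⟩ := lci_fin' hdim (n + 1) (N ⊔ Submodule.span B {a}) (fun P hP => ha P (by simpa using hP))
  set S1 := hV1.toFinset with hS1
  have memS1 : ∀ P, P ∈ S1 ↔ ¬ LciLG P.asIdeal (n + 1) (N ⊔ Submodule.span B {a}) := by
    intro P; simp [hS1]
  obtain ⟨b, hb⟩ := lci_avoid (fun P => if P ∈ S1 then n + 1 else n)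
    (fun P => if P ∈ S1 then N else N ⊔ Submodule.span B {a}) _
    (S1 ∪ (lci_finite_min (B := B)).toFinset) rfl (by
      intro P _
      by_cases hP : P ∈ S1
      · simpa [hP] using h P
      · simp only [hP, if_false]
        rw [memS1, not_not] at hP
        exact hP)
  have hb1 : ∀ P ∈ S1, LciLG P.asIdeal (n + 1) (N ⊔ Submodule.span B {b}) := by
    intro P hP
    have := hb P (Finset.mem_union_left _ hP)
    simpa only [hP, if_true] using this
  have hb2 : ∀ P : PrimeSpectrum B, P.asIdeal ∈ minimalPrimes B →
      LciLG P.asIdeal n (N ⊔ Submodule.span B {a} ⊔ Submodule.span B {b}) := by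
    intro P hP
    have hPS : P ∉ S1 := by
      rw [memS1, not_not]; exact ha P (by simpa using hP)
    have := hb P (Finset.mem_union_right _ (by simpa using hP))
    simpa only [hPS, if_false] using this
  obtain ⟨hV2, hV2m⟩ := lci_fin' hdim n _ hb2
  set S2 := hV2.toFinset with hS2
  have memS2 : ∀ P, P ∈ S2 ↔
      ¬ LciLG P.asIdeal n (N ⊔ Submodule.span B {a} ⊔ Submodule.span B {b}) := by
    intro P; simp [hS2]
  have hex : ∃ t, t ∈ ∏ Q ∈ S2 \ S1, Q.asIdeal ∧ ∀ P ∈ S1, t ∉ P.asIdeal := by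
    by_contra hcon
    push Not at hcon
    have hsub : ((∏ Q ∈ S2 \ S1, Q.asIdeal : Ideal B) : Set B) ⊆
        ⋃ P ∈ (S1 : Set (PrimeSpectrum B)), (P.asIdeal : Set B) := by
      intro t ht
      obtain ⟨P, hP, htP⟩ := hcon t ht
      simp only [Set.mem_iUnion]
      exact ⟨P, hP, htP⟩
    rcases S1.eq_empty_or_nonempty with h0 | ⟨P1, -⟩
    · rw [h0] at hcon
      obtain ⟨P, hP, -⟩ := hcon 0 (zero_mem _)
      simp at hP
    obtain ⟨P, hP, hle⟩ := (Ideal.subset_union_prime (f := fun P : PrimeSpectrum B => P.asIdeal)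
      P1 P1 (fun P _ _ _ => P.isPrime)).1 hsub
    obtain ⟨Q, hQ, hQP⟩ := (Ideal.IsPrime.prod_le P.isPrime).1 hle
    rw [Finset.mem_sdiff] at hQ
    have hQmax := hV2m Q ((memS2 Q).1 hQ.1)
    have := PrimeSpectrum.ext (hQmax.eq_of_le P.isPrime.ne_top hQP)
    subst this
    exact hQ.2 hP
  obtain ⟨t, ht, htS1⟩ := hex
  refine ⟨a + t • b, fun P => ?_⟩
  by_cases hP1 : P ∈ S1
  · -- here `a` vanishes, `b` does not
    have haZ := (lci_dich P.asIdeal (n + 1) N a (h P)).resolve_left ((memS1 P).1 hP1)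
    obtain ⟨s, hs, hsa⟩ := haZ
    refine lci_perturb P.asIdeal (n + 1) N b _ (hb1 P hP1)
      ⟨s * t, fun h => (P.isPrime.mem_or_mem h).elim hs (htS1 P hP1), ?_⟩
    have : (s * t) • b = s • (a + t • b) - s • a := by
      rw [smul_add, mul_smul]; abel
    rw [this]
    refine sub_mem (Submodule.smul_mem _ _ (Submodule.mem_sup_left (Submodule.mem_sup_right
        (Submodule.mem_span_singleton_self _)))) ?_
    exact (sup_le_sup_right le_sup_left _ : _ ≤ N ⊔ Submodule.span B {a + t • b} ⊔ _) hsa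
  · by_cases hP2 : P ∈ S2
    · have htP : t ∈ P.asIdeal :=
        (Ideal.prod_le_inf.trans (Finset.inf_le (Finset.mem_sdiff.2 ⟨hP2, hP1⟩))) ht
      rw [memS1, not_not] at hP1
      refine lci_perturb P.asIdeal (n + 1) N a _ hP1 ⟨1, P.asIdeal.one_notMem, ?_⟩
      have : (1 : B) • a = (a + t • b) + (-t) • b := by simp
      rw [this]
      refine add_mem (Submodule.mem_sup_left (Submodule.mem_sup_right
        (Submodule.mem_span_singleton_self _))) (Submodule.mem_sup_right ?_)
      exact Submodule.smul_mem_smul (neg_mem htP) trivial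
    · rw [memS2, not_not] at hP2
      obtain ⟨e, he⟩ := hP2
      refine ⟨Fin.cons b e, fun z => ?_⟩
      obtain ⟨s, hs, hz⟩ := he z
      refine ⟨s, hs, ?_⟩
      rw [Fin.range_cons, Submodule.span_insert]
      set X := N ⊔ Submodule.span B {a + t • b} ⊔
        (Submodule.span B {b} ⊔ Submodule.span B (Set.range e)) with hX
      have hbX : b ∈ X := Submodule.mem_sup_right (Submodule.mem_sup_left
        (Submodule.mem_span_singleton_self _))
      have haX : a ∈ X := by
        have : a = (a + t • b) - t • b := by abel
        rw [this]
        exact sub_mem (Submodule.mem_sup_left (Submodule.mem_sup_right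
          (Submodule.mem_span_singleton_self _))) (X.smul_mem _ hbX)
      have hle : N ⊔ Submodule.span B {a} ⊔ Submodule.span B {b} ⊔
          Submodule.span B (Set.range e) ≤ X := by
        refine sup_le (sup_le (sup_le (le_sup_left.trans le_sup_left) ?_) ?_)
          (le_sup_right.trans le_sup_right)
        · rwa [Submodule.span_singleton_le_iff_mem]
        · rwa [Submodule.span_singleton_le_iff_mem]
      exact hle hz

lemma lci_steps (hdim : ringKrullDim B ≤ 1) (m : ℕ) : ∀ (N : Submodule B E),
    (∀ P : PrimeSpectrum B, LciLG P.asIdeal (m + 1) N) →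
    ∃ l : List E, l.length = m ∧
      ∀ P : PrimeSpectrum B, LciLG P.asIdeal 1 (N ⊔ Submodule.span B {z | z ∈ l}) := by
  induction m with
  | zero => exact fun N h => ⟨[], rfl, by simpa using h⟩
  | succ m ih =>
    intro N h
    obtain ⟨a, ha⟩ := lci_step hdim m N h
    obtain ⟨l, hl, hLG⟩ := ih _ ha
    refine ⟨a :: l, by simp [hl], fun P => ?_⟩
    convert hLG P using 1
    have : {z | z ∈ a :: l} = insert a {z | z ∈ l} := by ext; simp
    rw [this, Submodule.span_insert, sup_assoc]

/-- Serre-type splitting over a Noetherian ring of dimension at most one. -/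
lemma lci_serre (hdim : ringKrullDim B ≤ 1) (m : ℕ)
    (h : ∀ P : PrimeSpectrum B, LciLG P.asIdeal (m + 1) (⊥ : Submodule B E)) :
    ∃ (l : List E) (x y : E) (f g p q : B), l.length = m ∧ f + g = 1 ∧
      Submodule.span B {z | z ∈ l} ⊔ Submodule.span B {x} ⊔ Submodule.span B {y} = ⊤ ∧
      f • y - p • x ∈ Submodule.span B {z | z ∈ l} ∧
      g • x - q • y ∈ Submodule.span B {z | z ∈ l} := by
  classical
  obtain ⟨l, hl, hLG⟩ := lci_steps hdim m _ h
  rw [bot_sup_eq] at hLG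
  set N := Submodule.span B {z | z ∈ l} with hN
  obtain ⟨x, hx⟩ := lci_avoid (fun _ => 0) (fun _ => N) _ (lci_finite_min (B := B)).toFinset rfl
    (fun P _ => hLG P)
  obtain ⟨hV, -⟩ := lci_fin' hdim 0 (N ⊔ Submodule.span B {x}) (fun P hP => hx P (by simpa using hP))
  obtain ⟨y, hy⟩ := lci_avoid (fun _ => 0) (fun _ => N) _ hV.toFinset rfl
    (fun P _ => hLG P)
  have hxy : ∀ P : PrimeSpectrum B, LciLG P.asIdeal 0 (N ⊔ Submodule.span B {x}) ∨
      LciLG P.asIdeal 0 (N ⊔ Submodule.span B {y}) := by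
    intro P
    by_cases hP : LciLG P.asIdeal 0 (N ⊔ Submodule.span B {x})
    · exact Or.inl hP
    · exact Or.inr (hy P (by simpa using hP))
  have htop : N ⊔ Submodule.span B {x} ⊔ Submodule.span B {y} = ⊤ := by
    rw [eq_top_iff]
    intro z _
    let K : Ideal B := (N ⊔ Submodule.span B {x} ⊔ Submodule.span B {y}).comap
      (LinearMap.toSpanSingleton B E z)
    suffices hK : K = ⊤ by
      have : (1 : B) ∈ K := by rw [hK]; trivial
      simpa [K] using this
    by_contra hne
    obtain ⟨M, hM, hKM⟩ := Ideal.exists_le_maximal K hne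
    rcases hxy ⟨M, hM.isPrime⟩ with h | h
    · obtain ⟨s, hs, hz⟩ := lci_LG_zero h z
      exact hs (hKM (show s • z ∈ N ⊔ Submodule.span B {x} ⊔ Submodule.span B {y} from Submodule.mem_sup_left hz))
    · obtain ⟨s, hs, hz⟩ := lci_LG_zero h z
      refine hs (hKM (show s • z ∈ N ⊔ Submodule.span B {x} ⊔ Submodule.span B {y} from ?_))
      exact (sup_le_sup_right le_sup_left _ : _ ≤ N ⊔ Submodule.span B {x} ⊔ _) hz
  let K1 : Ideal B := (N ⊔ Submodule.span B {x}).comap (LinearMap.toSpanSingleton B E y)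
  let K2 : Ideal B := (N ⊔ Submodule.span B {y}).comap (LinearMap.toSpanSingleton B E x)
  have hK : K1 ⊔ K2 = ⊤ := by
    by_contra hne
    obtain ⟨M, hM, hKM⟩ := Ideal.exists_le_maximal _ hne
    rcases hxy ⟨M, hM.isPrime⟩ with h | h
    · obtain ⟨s, hs, hz⟩ := lci_LG_zero h y
      exact hs (hKM (Submodule.mem_sup_left (show s • y ∈ N ⊔ Submodule.span B {x} from hz)))
    · obtain ⟨s, hs, hz⟩ := lci_LG_zero h x
      exact hs (hKM (Submodule.mem_sup_right (show s • x ∈ N ⊔ Submodule.span B {y} from hz)))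
  have h1 : (1 : B) ∈ K1 ⊔ K2 := by rw [hK]; trivial
  obtain ⟨f, hf, g, hg, hfg⟩ := Submodule.mem_sup.1 h1
  obtain ⟨ν, hν, w, hw, hsum⟩ := Submodule.mem_sup.1 (show f • y ∈ N ⊔ Submodule.span B {x} from hf)
  obtain ⟨p, rfl⟩ := Submodule.mem_span_singleton.1 hw
  obtain ⟨ν', hν', w', hw', hsum'⟩ := Submodule.mem_sup.1 (show g • x ∈ N ⊔ Submodule.span B {y} from hg)
  obtain ⟨q, rfl⟩ := Submodule.mem_span_singleton.1 hw'
  refine ⟨l, x, y, f, g, p, q, hl, hfg, htop, ?_, ?_⟩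
  · rw [← hsum]; simpa using hν
  · rw [← hsum']; simpa using hν'

end Gen


section Main
variable {A : Type*} [CommRing A]

lemma lci_unit_mul_mem {P : Ideal A} [P.IsPrime] {f : A} (hf : f ∉ P)
    (X : Ideal (Localization.AtPrime P)) (z : Localization.AtPrime P)
    (h : algebraMap A (Localization.AtPrime P) f * z ∈ X) : z ∈ X := by
  have hu : IsUnit (algebraMap A (Localization.AtPrime P) f) :=
    IsLocalization.map_units (Localization.AtPrime P) (⟨f, hf⟩ : P.primeCompl)
  exact (Ideal.unit_mul_mem_iff_mem X hu).1 h

lemma lci_local_mem (J : Ideal A) (c : A)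
    (h : ∀ (P : Ideal A) [P.IsPrime], J ≤ P → algebraMap A (Localization.AtPrime P) c ∈
      J.map (algebraMap A (Localization.AtPrime P))) : c ∈ J := by
  let K : Ideal A := Submodule.comap (LinearMap.toSpanSingleton A A c) J
  suffices hK : K = ⊤ by
    have : (1 : A) ∈ K := by rw [hK]; trivial
    simpa [K] using this
  by_contra hne
  obtain ⟨M, hM, hKM⟩ := Ideal.exists_le_maximal K hne
  have := hM.isPrime
  have hJK : J ≤ K := fun z hz => show z * c ∈ J from J.mul_mem_right _ hz
  have h1 := h M (hJK.trans hKM)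
  rw [IsLocalization.algebraMap_mem_map_algebraMap_iff M.primeCompl] at h1
  obtain ⟨s, hs, hsc⟩ := h1
  exact hs (hKM (show s * c ∈ J from hsc))

lemma lci_locgens [IsNoetherianRing A] (P : Ideal A) [P.IsPrime] (K : Ideal A) (X : List A)
    (hXK : Ideal.ofList X ≤ K) (f : A) (hf : f ∉ P)
    (h : ∀ z ∈ K, f * z ∈ Ideal.ofList X ⊔ P * K) :
    Ideal.ofList (X.map (algebraMap A (Localization.AtPrime P))) =
      K.map (algebraMap A (Localization.AtPrime P)) := by
  rw [← Ideal.map_ofList]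
  refine le_antisymm (Ideal.map_mono hXK) ?_
  refine Submodule.le_of_le_smul_of_le_jacobson_bot (I := IsLocalRing.maximalIdeal _)
    (IsNoetherian.noetherian _) (IsLocalRing.maximalIdeal_le_jacobson _) ?_
  rw [Ideal.map_le_iff_le_comap]
  intro z hz
  rw [Ideal.mem_comap]
  apply lci_unit_mul_mem hf
  rw [← map_mul]
  have := Ideal.mem_map_of_mem (algebraMap A (Localization.AtPrime P)) (h z hz)
  rw [Ideal.map_sup, Ideal.map_mul, Localization.AtPrime.map_eq_maximalIdeal] at this
  exact this

lemma lci_locreg [IsNoetherianRing A] (P : Ideal A) [P.IsPrime] (K : Ideal A) (r : ℕ)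
    (hK : ∃ rs : List (Localization.AtPrime P),
      rs.length = r ∧ RingTheory.Sequence.IsRegular (Localization.AtPrime P) rs ∧
      Ideal.ofList rs = K.map (algebraMap A (Localization.AtPrime P)))
    (X : List A) (hX : X.length = r)
    (hXK : Ideal.ofList X ≤ K) (f : A) (hf : f ∉ P)
    (h : ∀ z ∈ K, f * z ∈ Ideal.ofList X ⊔ P * K) :
    IsRegular (Localization.AtPrime P) (X.map (algebraMap A (Localization.AtPrime P))) := by
  obtain ⟨rs, hl, hreg, hid⟩ := hK
  exact lci_regular_of_gens rs _ hreg (by rw [hid, lci_locgens P K X hXK f hf h])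
    (by simp [hX, hl])

lemma lci_delta_aux {R : Type*} [CommRing R] (a : List R) (x d : R) (K : Ideal R)
    (hid : Ideal.ofList (a ++ [x]) = K)
    (hs : ∀ z, x * z ∈ Ideal.ofList a → z ∈ Ideal.ofList a)
    (h1 : d * x ∈ Ideal.ofList a ⊔ K * K) : d ∈ K := by
  rw [Ideal.ofList_append, Ideal.ofList_singleton] at hid
  have haI : Ideal.ofList a ≤ K := by
    rw [← hid]; exact le_sup_left
  have h2 : Ideal.ofList a ⊔ K * K ≤ Ideal.ofList a ⊔ K * Ideal.span {x} := by
    refine sup_le le_sup_left ?_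
    have h3 : K * K = K * Ideal.ofList a ⊔ K * Ideal.span {x} := by
      rw [← Ideal.mul_sup, hid]
    rw [h3]
    exact sup_le_sup_right Ideal.mul_le_right _
  obtain ⟨α, hα, β, hβ, hsum⟩ := Submodule.mem_sup.1 (h2 h1)
  obtain ⟨i, hi, rfl⟩ := Ideal.mem_mul_span_singleton.1 hβ
  have h3 : d - i ∈ Ideal.ofList a := by
    apply hs
    have : x * (d - i) = α := by linear_combination -hsum
    rw [this]; exact hα
  have : d = (d - i) + i := by ring
  rw [this]
  exact add_mem (haI h3) hi

lemma lci_delta [IsNoetherianRing A] (P : Ideal A) [P.IsPrime] (I : Ideal A) (hIP : I ≤ P) (r : ℕ)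
    (hI : ∃ rs : List (Localization.AtPrime P),
      rs.length = r ∧ RingTheory.Sequence.IsRegular (Localization.AtPrime P) rs ∧
      Ideal.ofList rs = I.map (algebraMap A (Localization.AtPrime P)))
    (a : List A) (x : A) (hX : (a ++ [x]).length = r)
    (hXK : Ideal.ofList (a ++ [x]) ≤ I) (f : A) (hf : f ∉ P)
    (h : ∀ z ∈ I, f * z ∈ Ideal.ofList (a ++ [x]) ⊔ I * I) (δ : A)
    (hδ : δ * x ∈ Ideal.ofList a ⊔ I * I) :
    algebraMap A (Localization.AtPrime P) δ ∈ I.map (algebraMap A (Localization.AtPrime P)) := by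
  have h' : ∀ z ∈ I, f * z ∈ Ideal.ofList (a ++ [x]) ⊔ P * I := fun z hz =>
    (sup_le_sup_left (Ideal.mul_mono_left hIP) _ : _ ≤ Ideal.ofList (a ++ [x]) ⊔ _) (h z hz)
  have hreg := lci_locreg P I r hI _ hX hXK f hf h'
  have hid := lci_locgens P I _ hXK f hf h'
  set φ := algebraMap A (Localization.AtPrime P)
  rw [List.map_append, List.map_singleton] at hreg hid
  have hs := lci_reg_snoc _ _ hreg
  have h1 := Ideal.mem_map_of_mem φ hδ
  rw [Ideal.map_sup, Ideal.map_mul, Ideal.map_ofList, map_mul] at h1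
  exact lci_delta_aux _ _ _ _ hid hs h1

lemma lci_LG [IsNoetherianRing A] (I : Ideal A) (r : ℕ)
    (hI : ∀ (P : Ideal A) [P.IsPrime], I ≤ P → ∃ rs : List (Localization.AtPrime P),
      rs.length = r ∧ RingTheory.Sequence.IsRegular (Localization.AtPrime P) rs ∧
      Ideal.ofList rs = I.map (algebraMap A (Localization.AtPrime P)))
    (Q : PrimeSpectrum (A ⧸ I)) :
    LciLG Q.asIdeal r (⊥ : Submodule (A ⧸ I) I.Cotangent) := by
  let P : Ideal A := Q.asIdeal.comap (Ideal.Quotient.mk I)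
  have hP : P.IsPrime := inferInstance
  have hIP : I ≤ P := fun z hz => by
    rw [Ideal.mem_comap, Ideal.Quotient.eq_zero_iff_mem.2 hz]; exact zero_mem _
  obtain ⟨rs, hl, -, hid⟩ := hI P hIP
  subst hl
  have h1 : ∀ i : Fin rs.length, ∃ (e : I) (s : P.primeCompl),
      rs.get i * algebraMap A (Localization.AtPrime P) s = algebraMap A _ (e : A) := by
    intro i
    have : rs.get i ∈ I.map (algebraMap A (Localization.AtPrime P)) := by
      rw [← hid]; exact Ideal.subset_span (List.get_mem _ _)
    obtain ⟨⟨e, s⟩, h⟩ := (IsLocalization.mem_map_algebraMap_iff P.primeCompl _).1 this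
    exact ⟨e, s, h⟩
  choose e s hes using h1
  refine ⟨fun i => I.toCotangent (e i), fun z => ?_⟩
  obtain ⟨z, rfl⟩ := I.toCotangent_surjective z
  have h2 : algebraMap A (Localization.AtPrime P) z ∈
      (Ideal.span (Set.range fun i => (e i : A))).map (algebraMap A (Localization.AtPrime P)) := by
    have hz : algebraMap A (Localization.AtPrime P) z ∈ Ideal.ofList rs := by
      rw [hid]; exact Ideal.mem_map_of_mem _ z.2
    refine (Ideal.span_le.2 ?_ : Ideal.ofList rs ≤ _) hz
    intro t ht
    obtain ⟨i, rfl⟩ := List.get_of_mem ht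
    apply lci_unit_mul_mem (s i).2
    rw [mul_comm, hes]
    exact Ideal.mem_map_of_mem _ (Ideal.subset_span ⟨i, rfl⟩)
  rw [IsLocalization.algebraMap_mem_map_algebraMap_iff P.primeCompl] at h2
  obtain ⟨t, ht, htz⟩ := h2
  obtain ⟨c, hc⟩ := (Ideal.mem_span_range_iff_exists_fun).1 htz
  refine ⟨Ideal.Quotient.mk I t, ht, ?_⟩
  rw [bot_sup_eq]
  have h3 : Ideal.Quotient.mk I t • I.toCotangent z = I.toCotangent (t • z) := by
    rw [map_smul]; rfl
  have h4 : t • z = ∑ i, c i • e i := by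
    ext; simp [hc]
  rw [h3, h4, map_sum]
  refine sum_mem fun i _ => ?_
  rw [map_smul]
  have : I.toCotangent (e i) ∈ Submodule.span (A ⧸ I) (Set.range fun i => I.toCotangent (e i)) :=
    Submodule.subset_span ⟨i, rfl⟩
  exact Submodule.smul_mem _ (Ideal.Quotient.mk I (c i)) this

end Main

section Alg
variable {A : Type*} [CommRing A]

lemma lci_sq (I J W : Ideal A) (t w : A) (hII : I * I ≤ J) (hw : w ∈ I)
    (h : ∀ z ∈ I, t * z ∈ W ⊔ Ideal.span {w} ⊔ I * I) :
    ∀ z ∈ I * I, t ^ 2 * z ∈ W ⊔ Ideal.span {w ^ 2} ⊔ I * J := by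
  intro z hz
  set X := W ⊔ Ideal.span {w ^ 2} ⊔ I * J with hX
  have hWX : W ≤ X := le_sup_left.trans le_sup_left
  have hIJX : I * J ≤ X := le_sup_right
  have hwX : w ^ 2 ∈ X := Ideal.mem_sup_left (Ideal.mem_sup_right (Ideal.mem_span_singleton_self _))
  refine Submodule.mul_induction_on hz (fun a ha b hb => ?_) (fun a b ha hb => ?_)
  · obtain ⟨u, hu, γ, hγ, h1⟩ := Submodule.mem_sup.1 (h a ha)
    obtain ⟨α, hα, v, hv, rfl⟩ := Submodule.mem_sup.1 hu
    obtain ⟨β, rfl⟩ := Ideal.mem_span_singleton'.1 hv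
    obtain ⟨u', hu', γ', hγ', h2⟩ := Submodule.mem_sup.1 (h b hb)
    obtain ⟨α', hα', v', hv', rfl⟩ := Submodule.mem_sup.1 hu'
    obtain ⟨β', rfl⟩ := Ideal.mem_span_singleton'.1 hv'
    have e : t ^ 2 * (a * b) = α * (t * b) + (β * w) * α' + (β * β') * w ^ 2 + β * (w * γ')
        + t * (b * γ) := by
      linear_combination (-t * b) * h1 - (β * w) * h2
    rw [e]
    refine add_mem (add_mem (add_mem (add_mem ?_ ?_) ?_) ?_) ?_
    · exact hWX (W.mul_mem_right _ hα)
    · exact hWX (W.mul_mem_left _ hα')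
    · exact X.mul_mem_left _ hwX
    · exact X.mul_mem_left _ (hIJX (Ideal.mul_mem_mul hw (hII hγ')))
    · exact X.mul_mem_left _ (hIJX (Ideal.mul_mem_mul hb (hII hγ)))
  · rw [mul_add]; exact add_mem ha hb

lemma lci_alg (I T : Ideal A) (hT : T ≤ I) (c x y f g p q : A) (hc : c ∈ I) (hx : x ∈ I)
    (hy : y ∈ I) (hfg : f + g = 1) (hδ : f * g - p * q ∈ I) (h1 : f * y - p * x ∈ I * I)
    (h2 : g * x - q * y ∈ I * I)
    (hgen : I ≤ T ⊔ Ideal.span {c} ⊔ Ideal.span {x} ⊔ Ideal.span {y} ⊔ I * I) :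
    ∃ (J : Ideal A) (k0 k2 z1 z2 : A), I * I ≤ J ∧ J ≤ I ∧ T ≤ J ∧ k0 ∈ J ∧ k2 ∈ J ∧
      z1 ∈ J ∧ z2 ∈ J ∧
      J ≤ T ⊔ Ideal.span {z1} ⊔ Ideal.span {z2} ⊔ I * J ∧
      (∀ z ∈ I, f ^ 2 * z ∈ T ⊔ Ideal.span {k0} ⊔ Ideal.span {c} ⊔ I * I) ∧
      (∀ z ∈ J, f ^ 6 * z ∈ T ⊔ Ideal.span {k0} ⊔ Ideal.span {c ^ 2} ⊔ I * J) ∧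
      (∀ z ∈ I, g ^ 2 * z ∈ T ⊔ Ideal.span {k2} ⊔ Ideal.span {y} ⊔ I * I) ∧
      (∀ z ∈ J, g ^ 6 * z ∈ T ⊔ Ideal.span {k2} ⊔ Ideal.span {y ^ 2} ⊔ I * J) := by
  obtain ⟨ρ1, hρ1⟩ : ∃ t, t = f * y - p * x := ⟨_, rfl⟩
  obtain ⟨ρ2, hρ2⟩ : ∃ t, t = g * x - q * y := ⟨_, rfl⟩
  obtain ⟨δ, hδe⟩ : ∃ t, t = f * g - p * q := ⟨_, rfl⟩
  rw [← hρ1] at h1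
  rw [← hρ2] at h2
  rw [← hδe] at hδ
  obtain ⟨k0, hk0⟩ : ∃ t, t = q ^ 2 * c + f * x := ⟨_, rfl⟩
  obtain ⟨k2, hk2⟩ : ∃ t, t = g ^ 2 * c + p * y := ⟨_, rfl⟩
  have hg : g = 1 - f := by linear_combination hfg
  let J : Ideal A := I * I ⊔ T ⊔ Ideal.span {k0} ⊔ Ideal.span {k2}
  have hIIJ : I * I ≤ J := le_sup_left.trans (le_sup_left.trans le_sup_left)
  have hTJ : T ≤ J := le_sup_right.trans (le_sup_left.trans le_sup_left)
  have hk0J : k0 ∈ J := Ideal.mem_sup_left (Ideal.mem_sup_right (Ideal.mem_span_singleton_self _))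
  have hk2J : k2 ∈ J := Ideal.mem_sup_right (Ideal.mem_span_singleton_self _)
  have hk0I : k0 ∈ I := by rw [hk0]; exact add_mem (I.mul_mem_left _ hc) (I.mul_mem_left _ hx)
  have hk2I : k2 ∈ I := by rw [hk2]; exact add_mem (I.mul_mem_left _ hc) (I.mul_mem_left _ hy)
  have hJI : J ≤ I := by
    refine sup_le (sup_le (sup_le Ideal.mul_le_left hT) ?_) ?_
    · rwa [Ideal.span_singleton_le_iff_mem]
    · rwa [Ideal.span_singleton_le_iff_mem]
  have hIIJJ : ∀ {a b}, a ∈ I → b ∈ I → a * b ∈ I * I := fun ha hb => Ideal.mul_mem_mul ha hb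
  -- the auxiliary elements
  obtain ⟨d1, hd1⟩ : ∃ t, t = f ^ 2 * k2 - p ^ 2 * k0 := ⟨_, rfl⟩
  obtain ⟨d2, hd2⟩ : ∃ t, t = g ^ 2 * k0 - q ^ 2 * k2 := ⟨_, rfl⟩
  have hd1I : d1 ∈ I * I := by
    have : d1 = (f * g + p * q) * (δ * c) + f * p * ρ1 := by
      rw [hd1, hk0, hk2, hδe, hρ1]; ring
    rw [this]
    exact add_mem (Ideal.mul_mem_left _ _ (hIIJJ hδ hc)) (Ideal.mul_mem_left _ _ h1)
  have hd2I : d2 ∈ I * I := by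
    have : d2 = g * f * ρ2 + q * (δ * y) := by
      rw [hd2, hk0, hk2, hδe, hρ2]; ring
    rw [this]
    exact add_mem (Ideal.mul_mem_left _ _ h2) (Ideal.mul_mem_left _ _ (hIIJJ hδ hy))
  have he1 : g ^ 2 * d1 + p ^ 2 * d2 ∈ I * J := by
    have : g ^ 2 * d1 + p ^ 2 * d2 = (f * g + p * q) * (δ * k2) := by
      rw [hd1, hd2, hδe]; ring
    rw [this]
    exact Ideal.mul_mem_left _ _ (Ideal.mul_mem_mul hδ hk2J)
  have he2 : q ^ 2 * d1 + f ^ 2 * d2 ∈ I * J := by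
    have : q ^ 2 * d1 + f ^ 2 * d2 = (f * g + p * q) * (δ * k0) := by
      rw [hd1, hd2, hδe]; ring
    rw [this]
    exact Ideal.mul_mem_left _ _ (Ideal.mul_mem_mul hδ hk0J)
  obtain ⟨η, hη⟩ : ∃ t, t = y - q * c := ⟨_, rfl⟩
  have hηI : η ∈ I := by rw [hη]; exact sub_mem hy (I.mul_mem_left _ hc)
  obtain ⟨j1, hj1⟩ : ∃ t, t = f * η + q * c := ⟨_, rfl⟩
  obtain ⟨j2, hj2⟩ : ∃ t, t = p * η + g * c := ⟨_, rfl⟩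
  have hj1J : j1 ∈ J := by
    have : j1 = p * k0 + q * k2 + (q * (δ * c) + f * ρ1 + δ * y) := by
      rw [hj1, hη, hδe, hρ1, hk0, hk2, hg]; ring
    rw [this]
    refine add_mem (add_mem (J.mul_mem_left _ hk0J) (J.mul_mem_left _ hk2J)) (hIIJ ?_)
    exact add_mem (add_mem (Ideal.mul_mem_left _ _ (hIIJJ hδ hc)) (Ideal.mul_mem_left _ _ h1))
      (hIIJJ hδ hy)
  have hj2J : j2 ∈ J := by
    have : j2 = k2 + δ * c := by
      rw [hj2, hη, hδe, hk2, hg]; ring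
    rw [this]
    exact add_mem hk2J (hIIJ (hIIJJ hδ hc))
  obtain ⟨u, hu⟩ : ∃ t, t = f + 3 * g := ⟨_, rfl⟩
  obtain ⟨v, hv⟩ : ∃ t, t = g + 3 * f := ⟨_, rfl⟩
  have huv : u * f ^ 2 + v * g ^ 2 = 1 := by rw [hu, hv, hg]; ring
  obtain ⟨z1, hz1⟩ : ∃ t, t = k0 - v * d2 - v * η ^ 2 := ⟨_, rfl⟩
  obtain ⟨z2, hz2⟩ : ∃ t, t = k2 - u * d1 + u * c ^ 2 := ⟨_, rfl⟩
  have hz1J : z1 ∈ J := by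
    rw [hz1]
    refine sub_mem (sub_mem hk0J (J.mul_mem_left _ (hIIJ hd2I))) (J.mul_mem_left _ (hIIJ ?_))
    rw [pow_two]; exact hIIJJ hηI hηI
  have hz2J : z2 ∈ J := by
    rw [hz2]
    refine add_mem (sub_mem hk2J (J.mul_mem_left _ (hIIJ hd1I))) (J.mul_mem_left _ (hIIJ ?_))
    rw [pow_two]; exact hIIJJ hc hc
  refine ⟨J, k0, k2, z1, z2, hIIJ, hJI, hTJ, hk0J, hk2J, hz1J, hz2J, ?_, ?_⟩
  · set D := T ⊔ Ideal.span {z1} ⊔ Ideal.span {z2} ⊔ I * J with hD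
    have hTD : T ≤ D := le_sup_left.trans (le_sup_left.trans le_sup_left)
    have hz1D : z1 ∈ D := Ideal.mem_sup_left (Ideal.mem_sup_left (Ideal.mem_sup_right
      (Ideal.mem_span_singleton_self _)))
    have hz2D : z2 ∈ D := Ideal.mem_sup_left (Ideal.mem_sup_right
      (Ideal.mem_span_singleton_self _))
    have hIJD : I * J ≤ D := le_sup_right
    have hcc : c * c ∈ D := by
      have : c * c = f ^ 2 * z2 - p ^ 2 * z1 - v * (g ^ 2 * d1 + p ^ 2 * d2)
          - (v * j2) * j2 + (2 * v * g) * (c * j2) := by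
        rw [hz1, hz2]
        have hη2 : p * η = j2 - g * c := by rw [hj2]; ring
        linear_combination (-(c * c) + d1) * huv + hd1 - v * (p * η + j2 - g * c) * hη2
      rw [this]
      refine add_mem (sub_mem (sub_mem (sub_mem (D.mul_mem_left _ hz2D) (D.mul_mem_left _ hz1D))
        (D.mul_mem_left _ (hIJD he1))) ?_) (D.mul_mem_left _ (hIJD (Ideal.mul_mem_mul hc hj2J)))
      exact hIJD (Ideal.mul_mem_mul (I.mul_mem_left _ (hJI hj2J)) hj2J)
    have hηη : η * η ∈ D := by
      have : η * η = q ^ 2 * z2 - g ^ 2 * z1 + u * (q ^ 2 * d1 + f ^ 2 * d2)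
          - (u * j1) * j1 + (2 * u * f) * (η * j1) := by
        rw [hz1, hz2]
        have hη2 : q * c = j1 - f * η := by rw [hj1]; ring
        linear_combination (-(η * η) - d2) * huv - hd2 - u * (q * c + j1 - f * η) * hη2
      rw [this]
      refine add_mem (sub_mem (add_mem (sub_mem (D.mul_mem_left _ hz2D) (D.mul_mem_left _ hz1D))
        (D.mul_mem_left _ (hIJD he2))) ?_) (D.mul_mem_left _ (hIJD (Ideal.mul_mem_mul hηI hj1J)))
      exact hIJD (Ideal.mul_mem_mul (I.mul_mem_left _ (hJI hj1J)) hj1J)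
    have hcη : c * η ∈ D := by
      have : c * η = c * j1 - q * (c * c) + η * j2 - p * (η * η) := by
        rw [hj1, hj2]; linear_combination (-(c * η)) * hfg
      rw [this]
      exact sub_mem (add_mem (sub_mem (hIJD (Ideal.mul_mem_mul hc hj1J)) (D.mul_mem_left _ hcc))
        (hIJD (Ideal.mul_mem_mul hηI hj2J))) (D.mul_mem_left _ hηη)
    have hIc : I ≤ Ideal.span {c, η} ⊔ J := by
      have hcm : c ∈ Ideal.span {c, η} ⊔ J := Ideal.mem_sup_left (Ideal.subset_span (by simp))
      have hηm : η ∈ Ideal.span {c, η} ⊔ J := Ideal.mem_sup_left (Ideal.subset_span (by simp))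
      refine hgen.trans (sup_le (sup_le (sup_le (sup_le (hTJ.trans le_sup_right) ?_) ?_) ?_)
        (hIIJ.trans le_sup_right))
      · rwa [Ideal.span_singleton_le_iff_mem]
      · rw [Ideal.span_singleton_le_iff_mem]
        have : x = q * η + (k0 + ρ2) := by rw [hη, hk0, hρ2, hg]; ring
        rw [this]
        exact add_mem (Ideal.mul_mem_left _ _ hηm) (Ideal.mem_sup_right (add_mem hk0J (hIIJ h2)))
      · rw [Ideal.span_singleton_le_iff_mem]
        have : y = g * η + j1 := by rw [hj1, hη, hg]; ring
        rw [this]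
        exact add_mem (Ideal.mul_mem_left _ _ hηm) (Ideal.mem_sup_right hj1J)
    have hS : Ideal.span {c, η} ≤ I := by
      rw [Ideal.span_le]
      rintro t (rfl | rfl)
      · exact hc
      · exact hηI
    have hIID : I * I ≤ D := by
      have e1 : I * I ≤ I * Ideal.span {c, η} ⊔ I * J := by
        rw [← Ideal.mul_sup]; exact Ideal.mul_mono_right hIc
      have e2 : I * Ideal.span {c, η} ≤ Ideal.span {c, η} * Ideal.span {c, η} ⊔ I * J := by
        calc I * Ideal.span {c, η} ≤ (Ideal.span {c, η} ⊔ J) * Ideal.span {c, η} :=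
              Ideal.mul_mono_left hIc
          _ = Ideal.span {c, η} * Ideal.span {c, η} ⊔ Ideal.span {c, η} * J := by
              rw [Ideal.sup_mul, mul_comm J]
          _ ≤ _ := sup_le_sup_left (Ideal.mul_mono_left hS) _
      refine e1.trans (sup_le (e2.trans (sup_le ?_ hIJD)) hIJD)
      rw [Ideal.span_pair_mul_span_pair, Ideal.span_le]
      rintro t (rfl | rfl | rfl | rfl)
      · exact hcc
      · exact hcη
      · rw [mul_comm]; exact hcη
      · exact hηη
    refine sup_le (sup_le (sup_le hIID hTD) ?_) ?_
    · rw [Ideal.span_singleton_le_iff_mem]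
      have : k0 = z1 + v * d2 + v * (η * η) := by rw [hz1]; ring
      rw [this]
      exact add_mem (add_mem hz1D (D.mul_mem_left _ (hIID hd2I))) (D.mul_mem_left _ hηη)
    · rw [Ideal.span_singleton_le_iff_mem]
      have : k2 = z2 + u * d1 - u * (c * c) := by rw [hz2]; ring
      rw [this]
      exact sub_mem (add_mem hz2D (D.mul_mem_left _ (hIID hd1I))) (D.mul_mem_left _ hcc)
  · have hgenT : ∀ (t : A) (X : Ideal A), T ≤ X → I * I ≤ X → t * c ∈ X → t * x ∈ X → t * y ∈ X →
        ∀ z ∈ I, t * z ∈ X := by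
      intro t X hTX hIX hcX hxX hyX z hz
      have : I ≤ Submodule.comap (LinearMap.mulLeft A t) X := by
        refine hgen.trans (sup_le (sup_le (sup_le (sup_le ?_ ?_) ?_) ?_) ?_)
        · intro w hw
          exact X.mul_mem_left _ (hTX hw)
        · rw [Ideal.span_le, Set.singleton_subset_iff]
          exact hcX
        · rw [Ideal.span_le, Set.singleton_subset_iff]
          exact hxX
        · rw [Ideal.span_le, Set.singleton_subset_iff]
          exact hyX
        · intro w hw
          exact X.mul_mem_left _ (hIX hw)
      exact this hz
    have hgenJ : ∀ (t : A) (X : Ideal A), T ≤ X → (∀ z ∈ I * I, t * z ∈ X) → t * k0 ∈ X →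
        t * k2 ∈ X → ∀ z ∈ J, t * z ∈ X := by
      intro t X hTX hIX hcX hxX z hz
      have : J ≤ Submodule.comap (LinearMap.mulLeft A t) X := by
        refine sup_le (sup_le (sup_le ?_ ?_) ?_) ?_
        · intro w hw
          exact hIX w hw
        · intro w hw
          exact X.mul_mem_left _ (hTX hw)
        · rw [Ideal.span_le, Set.singleton_subset_iff]
          exact hcX
        · rw [Ideal.span_le, Set.singleton_subset_iff]
          exact hxX
      exact this hz
    have hf1 : ∀ z ∈ I, f ^ 2 * z ∈ T ⊔ Ideal.span {k0} ⊔ Ideal.span {c} ⊔ I * I := by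
      set X := T ⊔ Ideal.span {k0} ⊔ Ideal.span {c} ⊔ I * I with hX
      have hTX : T ≤ X := le_sup_left.trans (le_sup_left.trans le_sup_left)
      have hkX : k0 ∈ X := Ideal.mem_sup_left (Ideal.mem_sup_left (Ideal.mem_sup_right
        (Ideal.mem_span_singleton_self _)))
      have hcX : c ∈ X := Ideal.mem_sup_left (Ideal.mem_sup_right (Ideal.mem_span_singleton_self _))
      have hIX : I * I ≤ X := le_sup_right
      have hxX : f * x ∈ X := by
        have : f * x = k0 - q ^ 2 * c := by rw [hk0]; ring
        rw [this]; exact sub_mem hkX (X.mul_mem_left _ hcX)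
      refine hgenT _ X hTX hIX (X.mul_mem_left _ hcX) ?_ ?_
      · rw [pow_two, mul_assoc]; exact X.mul_mem_left _ hxX
      · have : f ^ 2 * y = p * (f * x) + f * ρ1 := by rw [hρ1]; ring
        rw [this]; exact add_mem (X.mul_mem_left _ hxX) (X.mul_mem_left _ (hIX h1))
    have hg1 : ∀ z ∈ I, g ^ 2 * z ∈ T ⊔ Ideal.span {k2} ⊔ Ideal.span {y} ⊔ I * I := by
      set X := T ⊔ Ideal.span {k2} ⊔ Ideal.span {y} ⊔ I * I with hX
      have hTX : T ≤ X := le_sup_left.trans (le_sup_left.trans le_sup_left)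
      have hkX : k2 ∈ X := Ideal.mem_sup_left (Ideal.mem_sup_left (Ideal.mem_sup_right
        (Ideal.mem_span_singleton_self _)))
      have hyX : y ∈ X := Ideal.mem_sup_left (Ideal.mem_sup_right (Ideal.mem_span_singleton_self _))
      have hIX : I * I ≤ X := le_sup_right
      refine hgenT _ X hTX hIX ?_ ?_ (X.mul_mem_left _ hyX)
      · have : g ^ 2 * c = k2 - p * y := by rw [hk2]; ring
        rw [this]; exact sub_mem hkX (X.mul_mem_left _ hyX)
      · have : g ^ 2 * x = g * q * y + g * ρ2 := by rw [hρ2]; ring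
        rw [this]; exact add_mem (X.mul_mem_left _ hyX) (X.mul_mem_left _ (hIX h2))
    have hf2 := lci_sq I J (T ⊔ Ideal.span {k0}) (f ^ 2) c hIIJ hc hf1
    have hg2 := lci_sq I J (T ⊔ Ideal.span {k2}) (g ^ 2) y hIIJ hy hg1
    refine ⟨hf1, ?_, hg1, ?_⟩
    · set X := T ⊔ Ideal.span {k0} ⊔ Ideal.span {c ^ 2} ⊔ I * J with hX
      have hTX : T ≤ X := le_sup_left.trans (le_sup_left.trans le_sup_left)
      have hkX : k0 ∈ X := Ideal.mem_sup_left (Ideal.mem_sup_left (Ideal.mem_sup_right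
        (Ideal.mem_span_singleton_self _)))
      refine hgenJ _ X hTX (fun z hz => ?_) (X.mul_mem_left _ hkX) ?_
      · have : f ^ 6 * z = f ^ 2 * ((f ^ 2) ^ 2 * z) := by ring
        rw [this]; exact X.mul_mem_left _ (hf2 z hz)
      · have : f ^ 6 * k2 = f ^ 4 * p ^ 2 * k0 + (f ^ 2) ^ 2 * d1 := by rw [hd1]; ring
        rw [this]; exact add_mem (X.mul_mem_left _ hkX) (hf2 _ hd1I)
    · set X := T ⊔ Ideal.span {k2} ⊔ Ideal.span {y ^ 2} ⊔ I * J with hX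
      have hTX : T ≤ X := le_sup_left.trans (le_sup_left.trans le_sup_left)
      have hkX : k2 ∈ X := Ideal.mem_sup_left (Ideal.mem_sup_left (Ideal.mem_sup_right
        (Ideal.mem_span_singleton_self _)))
      refine hgenJ _ X hTX (fun z hz => ?_) ?_ (X.mul_mem_left _ hkX)
      · have : g ^ 6 * z = g ^ 2 * ((g ^ 2) ^ 2 * z) := by ring
        rw [this]; exact X.mul_mem_left _ (hg2 z hz)
      · have : g ^ 6 * k0 = g ^ 4 * q ^ 2 * k2 + (g ^ 2) ^ 2 * d2 := by rw [hd2]; ring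
        rw [this]; exact add_mem (X.mul_mem_left _ hkX) (hg2 _ hd2I)

end Alg

section Assemble
variable {A : Type*} [CommRing A]

lemma lci_cot_mem (I : Ideal A) (L : List I) (w : I.Cotangent)
    (hw : w ∈ Submodule.span (A ⧸ I) {u | u ∈ L.map I.toCotangent}) :
    ∀ z : I, I.toCotangent z = w → (z : A) ∈ Ideal.ofList (L.map (fun t : I => (t : A))) ⊔ I * I := by
  have key : ∀ z z' : I, I.toCotangent z = I.toCotangent z' →
      (z' : A) ∈ Ideal.ofList (L.map (fun t : I => (t : A))) ⊔ I * I →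
      (z : A) ∈ Ideal.ofList (L.map (fun t : I => (t : A))) ⊔ I * I := by
    intro z z' h hz'
    have h1 : (z : A) - z' ∈ I ^ 2 := (Ideal.toCotangent_eq I).1 h
    rw [pow_two] at h1
    have : (z : A) = (z - z') + z' := by ring
    rw [this]
    exact add_mem (Ideal.mem_sup_right h1) hz'
  induction hw using Submodule.span_induction with
  | mem u hu =>
    intro z hz
    obtain ⟨z', hz', rfl⟩ := List.mem_map.1 hu
    exact key z z' hz (Ideal.mem_sup_left (Ideal.subset_span (List.mem_map.2 ⟨z', hz', rfl⟩)))
  | zero =>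
    intro z hz
    exact key z 0 (by rw [hz, map_zero]) (zero_mem _)
  | add u v _ _ hu hv =>
    intro z hz
    obtain ⟨z1, rfl⟩ := I.toCotangent_surjective u
    obtain ⟨z2, rfl⟩ := I.toCotangent_surjective v
    exact key z (z1 + z2) (by rw [hz, map_add]) (add_mem (hu z1 rfl) (hv z2 rfl))
  | smul t u _ hu =>
    intro z hz
    obtain ⟨z1, rfl⟩ := I.toCotangent_surjective u
    obtain ⟨t, rfl⟩ := Ideal.Quotient.mk_surjective t
    have h3 : Ideal.Quotient.mk I t • I.toCotangent z1 = I.toCotangent (t • z1) := by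
      rw [map_smul]; rfl
    exact key z (t • z1) (by rw [hz, h3]) (Ideal.mul_mem_left _ _ (hu z1 rfl))

lemma lci_lift [IsNoetherianRing A] (I : Ideal A) (m : ℕ)
    (hI : ∀ (P : Ideal A) [P.IsPrime], I ≤ P → ∃ rs : List (Localization.AtPrime P),
      rs.length = m + 1 ∧ RingTheory.Sequence.IsRegular (Localization.AtPrime P) rs ∧
      Ideal.ofList rs = I.map (algebraMap A (Localization.AtPrime P)))
    (hdim : ringKrullDim (A ⧸ I) ≤ 1) :
    ∃ (a : List A) (x y f g p q : A), a.length = m ∧ Ideal.ofList a ≤ I ∧ x ∈ I ∧ y ∈ I ∧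
      f + g = 1 ∧ I ≤ Ideal.ofList a ⊔ Ideal.span {x} ⊔ Ideal.span {y} ⊔ I * I ∧
      f * y - p * x ∈ Ideal.ofList a ⊔ I * I ∧ g * x - q * y ∈ Ideal.ofList a ⊔ I * I := by
  have : Module.Finite A I.Cotangent :=
    Module.Finite.of_surjective I.toCotangent I.toCotangent_surjective
  have : Module.Finite (A ⧸ I) I.Cotangent := Module.Finite.of_restrictScalars_finite A _ _
  obtain ⟨l, x, y, f, g, p, q, hl, hfg, hgen, h1, h2⟩ :=
    lci_serre (B := A ⧸ I) (E := I.Cotangent) hdim m (lci_LG I (m + 1) hI)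
  obtain ⟨x, rfl⟩ := I.toCotangent_surjective x
  obtain ⟨y, rfl⟩ := I.toCotangent_surjective y
  obtain ⟨f, rfl⟩ := Ideal.Quotient.mk_surjective f
  obtain ⟨g, rfl⟩ := Ideal.Quotient.mk_surjective g
  obtain ⟨p, rfl⟩ := Ideal.Quotient.mk_surjective p
  obtain ⟨q, rfl⟩ := Ideal.Quotient.mk_surjective q
  obtain ⟨L, rfl⟩ : ∃ L : List I, L.map I.toCotangent = l :=
    List.map_surjective_iff.2 I.toCotangent_surjective l
  have hsm : ∀ (t : A) (z : I), Ideal.Quotient.mk I t • I.toCotangent z = I.toCotangent (t • z) := by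
    intro t z; rw [map_smul]; rfl
  have hg' : Ideal.Quotient.mk I (1 - f) = Ideal.Quotient.mk I g := by
    rw [map_sub, map_one, ← hfg]; ring
  rw [← hg'] at h2
  rw [hsm, hsm, ← map_sub] at h1 h2
  refine ⟨L.map (fun t : I => (t : A)), x, y, f, 1 - f, p, q, by simpa using hl, ?_, x.2, y.2,
    by ring, ?_, ?_, ?_⟩
  · rw [Ideal.ofList, Ideal.span_le]
    intro t ht
    obtain ⟨z, hz, rfl⟩ := List.mem_map.1 ht
    exact z.2
  · intro z hz
    have hz1 : I.toCotangent ⟨z, hz⟩ ∈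
        Submodule.span (A ⧸ I) {u | u ∈ (L ++ [x] ++ [y]).map I.toCotangent} := by
      have : I.toCotangent ⟨z, hz⟩ ∈ (⊤ : Submodule (A ⧸ I) I.Cotangent) := trivial
      rw [← hgen] at this
      refine (sup_le (sup_le ?_ ?_) ?_ : _ ≤ Submodule.span (A ⧸ I)
        {u | u ∈ (L ++ [x] ++ [y]).map I.toCotangent}) this
      · apply Submodule.span_mono
        intro u hu
        simp only [Set.mem_ofPred_eq, List.map_append, List.mem_append] at hu ⊢
        exact Or.inl (Or.inl hu)
      · apply Submodule.span_mono
        rintro u rfl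
        simp
      · apply Submodule.span_mono
        rintro u rfl
        simp
    have := lci_cot_mem I _ _ hz1 _ rfl
    simpa [Ideal.ofList_append, sup_assoc] using this
  · exact lci_cot_mem I _ _ h1 _ rfl
  · exact lci_cot_mem I _ _ h2 _ rfl

end Assemble

section Final
variable {A : Type*} [CommRing A]

lemma lci_delta_mem [IsNoetherianRing A] (I : Ideal A) (m : ℕ)
    (hI : ∀ (P : Ideal A) [P.IsPrime], I ≤ P → ∃ rs : List (Localization.AtPrime P),
      rs.length = m + 1 ∧ RingTheory.Sequence.IsRegular (Localization.AtPrime P) rs ∧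
      Ideal.ofList rs = I.map (algebraMap A (Localization.AtPrime P)))
    (a : List A) (x y f g p q : A) (ha : a.length = m) (haI : Ideal.ofList a ≤ I) (hx : x ∈ I)
    (hy : y ∈ I) (hfg : f + g = 1)
    (hgen : I ≤ Ideal.ofList a ⊔ Ideal.span {x} ⊔ Ideal.span {y} ⊔ I * I)
    (h1 : f * y - p * x ∈ Ideal.ofList a ⊔ I * I)
    (h2 : g * x - q * y ∈ Ideal.ofList a ⊔ I * I) : f * g - p * q ∈ I := by
  set S := Ideal.ofList a with hS
  have hδx : (f * g - p * q) * x ∈ S ⊔ I * I := by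
    have : (f * g - p * q) * x = f * (g * x - q * y) + q * (f * y - p * x) := by ring
    rw [this]
    exact add_mem (Ideal.mul_mem_left _ _ h2) (Ideal.mul_mem_left _ _ h1)
  have hδy : (f * g - p * q) * y ∈ S ⊔ I * I := by
    have : (f * g - p * q) * y = p * (g * x - q * y) + g * (f * y - p * x) := by ring
    rw [this]
    exact add_mem (Ideal.mul_mem_left _ _ h2) (Ideal.mul_mem_left _ _ h1)
  have hap : ∀ w : A, Ideal.ofList (a ++ [w]) = S ⊔ Ideal.span {w} := by
    intro w; rw [Ideal.ofList_append, Ideal.ofList_singleton]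
  have hgenT : ∀ (t : A) (X : Ideal A), S ⊔ I * I ≤ X → t * x ∈ X → t * y ∈ X →
      ∀ z ∈ I, t * z ∈ X := by
    intro t X hSX hxX hyX z hz
    have : I ≤ Submodule.comap (LinearMap.mulLeft A t) X := by
      refine hgen.trans (sup_le (sup_le (sup_le ?_ ?_) ?_) ?_)
      · intro w hw
        exact X.mul_mem_left _ (hSX (Ideal.mem_sup_left hw))
      · rw [Ideal.span_le, Set.singleton_subset_iff]
        exact hxX
      · rw [Ideal.span_le, Set.singleton_subset_iff]
        exact hyX
      · intro w hw
        exact X.mul_mem_left _ (hSX (Ideal.mem_sup_right hw))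
    exact this hz
  apply lci_local_mem I
  intro P hP hIP
  by_cases hf : f ∈ P
  · have hg : g ∉ P := by
      intro hg
      exact hP.ne_top ((Ideal.eq_top_iff_one _).2 (hfg ▸ add_mem hf hg))
    refine lci_delta P I hIP (m + 1) (hI P hIP) a y (by simp [ha]) ?_ g hg ?_ _ hδy
    · rw [hap]; exact sup_le haI ((Ideal.span_singleton_le_iff_mem _).2 hy)
    · have hle : S ⊔ I * I ≤ Ideal.ofList (a ++ [y]) ⊔ I * I := by
        rw [hap]; exact sup_le_sup_right le_sup_left _
      have hyX : y ∈ Ideal.ofList (a ++ [y]) ⊔ I * I := by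
        rw [hap]
        exact Ideal.mem_sup_left (Ideal.mem_sup_right (Ideal.mem_span_singleton_self _))
      refine hgenT g _ hle ?_ (Ideal.mul_mem_left _ _ hyX)
      have : g * x = (g * x - q * y) + q * y := by ring
      rw [this]
      exact add_mem (hle h2) (Ideal.mul_mem_left _ _ hyX)
  · refine lci_delta P I hIP (m + 1) (hI P hIP) a x (by simp [ha]) ?_ f hf ?_ _ hδx
    · rw [hap]; exact sup_le haI ((Ideal.span_singleton_le_iff_mem _).2 hx)
    · have hle : S ⊔ I * I ≤ Ideal.ofList (a ++ [x]) ⊔ I * I := by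
        rw [hap]; exact sup_le_sup_right le_sup_left _
      have hxX : x ∈ Ideal.ofList (a ++ [x]) ⊔ I * I := by
        rw [hap]
        exact Ideal.mem_sup_left (Ideal.mem_sup_right (Ideal.mem_span_singleton_self _))
      refine hgenT f _ hle (Ideal.mul_mem_left _ _ hxX) ?_
      have : f * y = (f * y - p * x) + p * x := by ring
      rw [this]
      exact add_mem (hle h1) (Ideal.mul_mem_left _ _ hxX)

lemma lci_sq_at [IsNoetherianRing A] (P : Ideal A) [P.IsPrime] (I J : Ideal A) (hIP : I ≤ P)
    (r : ℕ) (hI : ∃ rs : List (Localization.AtPrime P),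
      rs.length = r ∧ RingTheory.Sequence.IsRegular (Localization.AtPrime P) rs ∧
      Ideal.ofList rs = I.map (algebraMap A (Localization.AtPrime P)))
    (hII : I * I ≤ J) (hJI : J ≤ I) (a : List A) (k w : A) (ha : a.length + 2 = r)
    (haJ : Ideal.ofList a ≤ J) (hk : k ∈ J) (hw : w ∈ I) (f : A) (hf : f ∉ P)
    (h1 : ∀ z ∈ I, f ^ 2 * z ∈ Ideal.ofList a ⊔ Ideal.span {k} ⊔ Ideal.span {w} ⊔ I * I)
    (h2 : ∀ z ∈ J, f ^ 6 * z ∈ Ideal.ofList a ⊔ Ideal.span {k} ⊔ Ideal.span {w ^ 2} ⊔ I * J) :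
    ∃ rs : List (Localization.AtPrime P),
      rs.length = r ∧ RingTheory.Sequence.IsRegular (Localization.AtPrime P) rs ∧
      Ideal.ofList rs = J.map (algebraMap A (Localization.AtPrime P)) := by
  have hap : ∀ w : A, Ideal.ofList (a ++ [k] ++ [w]) =
      Ideal.ofList a ⊔ Ideal.span {k} ⊔ Ideal.span {w} := by
    intro w; rw [Ideal.ofList_append, Ideal.ofList_append, Ideal.ofList_singleton,
      Ideal.ofList_singleton]
  have hpow : ∀ n, f ^ n ∉ P := fun n hn => hf (Ideal.IsPrime.mem_of_pow_mem ‹_› n hn)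
  have hreg := lci_locreg P I r hI (a ++ [k] ++ [w]) (by simp; omega) (by
    rw [hap]
    exact sup_le (sup_le (haJ.trans hJI) ((Ideal.span_singleton_le_iff_mem _).2 (hJI hk)))
      ((Ideal.span_singleton_le_iff_mem _).2 hw)) (f ^ 2) (hpow 2) (fun z hz => by
    rw [hap]
    exact (sup_le_sup_left (Ideal.mul_mono_left hIP) _ :
      Ideal.ofList a ⊔ Ideal.span {k} ⊔ Ideal.span {w} ⊔ I * I ≤ _) (h1 z hz))
  rw [List.map_append] at hreg
  have hreg2 := lci_snoc_pow _ _ hreg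
  rw [← map_pow] at hreg2
  have hid := lci_locgens P J (a ++ [k] ++ [w ^ 2]) (by
    rw [hap]
    refine sup_le (sup_le haJ ((Ideal.span_singleton_le_iff_mem _).2 hk))
      ((Ideal.span_singleton_le_iff_mem _).2 (hII ?_))
    rw [pow_two]; exact Ideal.mul_mem_mul hw hw) (f ^ 6) (hpow 6) (fun z hz => by
    rw [hap]
    exact (sup_le_sup_left (Ideal.mul_mono_left hIP) _ :
      Ideal.ofList a ⊔ Ideal.span {k} ⊔ Ideal.span {w ^ 2} ⊔ I * J ≤ _) (h2 z hz))
  refine ⟨_, ?_, hreg2, ?_⟩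
  · simp; omega
  · rw [← hid]; simp only [List.map_append, List.map_cons, List.map_nil]

lemma lci_free [IsNoetherianRing A] (I J : Ideal A) (r : ℕ)
    (hJ : ∀ (P : Ideal A) [P.IsPrime], J ≤ P → ∃ rs : List (Localization.AtPrime P),
      rs.length = r ∧ RingTheory.Sequence.IsRegular (Localization.AtPrime P) rs ∧
      Ideal.ofList rs = J.map (algebraMap A (Localization.AtPrime P)))
    (hIP : ∀ (P : Ideal A) [P.IsPrime], J ≤ P → I ≤ P) (hII : I * I ≤ J)
    (Z : List A) (hZ : Z.length = r) (hZJ : Ideal.ofList Z ≤ J)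
    (hgen : J ≤ Ideal.ofList Z ⊔ I * J) :
    Nonempty (Module.Basis (Fin r) (A ⧸ J) J.Cotangent) := by
  subst hZ
  obtain ⟨e, he⟩ : ∃ e : Fin Z.length → A, List.ofFn e = Z := ⟨Z.get, List.ofFn_get Z⟩
  have hspan : Ideal.ofList Z = Ideal.span (Set.range e) := by
    rw [← lci_ofList_ofFn, he]
  have hgen2 : J ≤ Ideal.ofList Z ⊔ J ^ 2 := by
    have h1 : I * J ≤ Ideal.ofList Z ⊔ J ^ 2 := by
      calc I * J ≤ I * (Ideal.ofList Z ⊔ I * J) := Ideal.mul_mono_right hgen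
        _ = I * Ideal.ofList Z ⊔ (I * I) * J := by rw [Ideal.mul_sup, mul_assoc]
        _ ≤ Ideal.ofList Z ⊔ J ^ 2 := by
          rw [pow_two]
          exact sup_le_sup Ideal.mul_le_right (Ideal.mul_mono_left hII)
    exact hgen.trans (sup_le le_sup_left h1)
  refine lci_basis J e (fun i => hZJ ?_) (hspan ▸ hgen2) ?_
  · rw [hspan]; exact Ideal.subset_span ⟨i, rfl⟩
  · intro c hc i
    apply lci_local_mem J
    intro P hP hJP
    have hone : (1 : A) ∉ P := fun h => hP.ne_top ((Ideal.eq_top_iff_one _).2 h)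
    have hh : ∀ z ∈ J, 1 * z ∈ Ideal.ofList Z ⊔ P * J := fun z hz => by
      rw [one_mul]
      exact (sup_le_sup_left (Ideal.mul_mono_left (hIP P hJP)) _ : Ideal.ofList Z ⊔ I * J ≤ _)
        (hgen hz)
    have hreg := lci_locreg P J _ (hJ P hJP) Z rfl hZJ 1 hone hh
    have hid := lci_locgens P J Z hZJ 1 hone hh
    set φ := algebraMap A (Localization.AtPrime P) with hφ
    have hmap : Z.map φ = List.ofFn (fun i => φ (e i)) := by
      conv_lhs => rw [← he]
      rw [List.map_ofFn]; rfl
    rw [hmap] at hreg hid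
    rw [lci_ofList_ofFn] at hid
    have := lci_reg_ind _ hreg (fun i => φ (c i)) (by
      rw [hid, ← Ideal.map_pow]
      have := Ideal.mem_map_of_mem φ hc
      simpa [map_sum, map_mul] using this) i
    rw [hid] at this
    exact this

lemma lci_height_congr (I J : Ideal A) (h : ∀ P : PrimeSpectrum A, I ≤ P.asIdeal ↔ J ≤ P.asIdeal) :
    idealHeight I = idealHeight J := by
  unfold idealHeight
  simp only [h]

end Final

/-- Ferrand–Szpiro: for a local complete intersection ideal `I` of height
`r ≥ 2` with `dim(A/I) ≤ 1` in a Noetherian ring, there is a local complete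
intersection ideal `J` of height `r` with `√I = √J` whose conormal module
`J/J²` is free of rank `r` over `A/J`. -/
theorem exists_lci_ideal_same_radical_with_free_conormal_of_dim_quot_le_one
    {A : Type*} [CommRing A] [IsNoetherianRing A]
    (I : Ideal A) (r : ℕ) (hr : 2 ≤ r)
    (hI : IsLocalCompleteIntersectionOfHeight I r)
    (hdim : ringKrullDim (A ⧸ I) ≤ 1) :
    ∃ J : Ideal A, I.radical = J.radical ∧
      IsLocalCompleteIntersectionOfHeight J r ∧
      Nonempty (Module.Basis (Fin r) (A ⧸ J) J.Cotangent) := by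
  obtain ⟨n, rfl⟩ : ∃ n, r = n + 1 + 1 := ⟨r - 2, by omega⟩
  obtain ⟨hht, hI⟩ := hI
  obtain ⟨a, x0, y0, f, g, p, q, ha, haI, hx0, hy0, hfg, hgen0, hD1, hD2⟩ :=
    lci_lift I (n + 1) hI hdim
  have hδ := lci_delta_mem I (n + 1) hI a x0 y0 f g p q ha haI hx0 hy0 hfg hgen0 hD1 hD2
  have hSI : Ideal.ofList a ⊔ I * I ≤ I := sup_le haI Ideal.mul_le_left
  obtain ⟨x, hx⟩ : ∃ x, x = x0 - (g * x0 - q * y0) := ⟨_, rfl⟩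
  obtain ⟨y, hy⟩ : ∃ y, y = y0 - (f * y0 - p * x0) := ⟨_, rfl⟩
  have hxI : x ∈ I := by rw [hx]; exact sub_mem hx0 (hSI hD2)
  have hyI : y ∈ I := by rw [hy]; exact sub_mem hy0 (hSI hD1)
  have hgf : g = 1 - f := by linear_combination hfg
  have h1 : f * y - p * x ∈ I * I := by
    have : f * y - p * x = (f * g - p * q) * y0 := by rw [hx, hy, hgf]; ring
    rw [this]; exact Ideal.mul_mem_mul hδ hy0
  have h2 : g * x - q * y ∈ I * I := by
    have : g * x - q * y = (f * g - p * q) * x0 := by rw [hx, hy, hgf]; ring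
    rw [this]; exact Ideal.mul_mem_mul hδ hx0
  have hgen1 : I ≤ Ideal.ofList a ⊔ Ideal.span {x} ⊔ Ideal.span {y} ⊔ I * I := by
    set X := Ideal.ofList a ⊔ Ideal.span {x} ⊔ Ideal.span {y} ⊔ I * I with hX
    have hSX : Ideal.ofList a ⊔ I * I ≤ X :=
      sup_le (le_sup_left.trans (le_sup_left.trans le_sup_left)) le_sup_right
    have hxX : x ∈ X := Ideal.mem_sup_left (Ideal.mem_sup_left (Ideal.mem_sup_right
        (Ideal.mem_span_singleton_self _)))
    have hyX : y ∈ X := Ideal.mem_sup_left (Ideal.mem_sup_right (Ideal.mem_span_singleton_self _))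
    refine hgen0.trans (sup_le (sup_le (sup_le (le_sup_left.trans hSX) ?_) ?_)
      (le_sup_right.trans hSX))
    · rw [Ideal.span_singleton_le_iff_mem]
      have : x0 = x + (g * x0 - q * y0) := by rw [hx]; ring
      rw [this]; exact add_mem hxX (hSX hD2)
    · rw [Ideal.span_singleton_le_iff_mem]
      have : y0 = y + (f * y0 - p * x0) := by rw [hy]; ring
      rw [this]; exact add_mem hyX (hSX hD1)
  obtain ⟨c, a', rfl⟩ : ∃ c a', a = c :: a' := List.exists_cons_of_length_eq_add_one ha
  have hn : a'.length = n := by simpa using ha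
  rw [Ideal.ofList_cons] at haI hgen1
  have hcI : c ∈ I := haI (Ideal.mem_sup_left (Ideal.mem_span_singleton_self _))
  have hTI : Ideal.ofList a' ≤ I := le_sup_right.trans haI
  rw [sup_comm (Ideal.span {c})] at hgen1
  obtain ⟨J, k0, k2, z1, z2, hIIJ, hJI, hTJ, hk0, hk2, hz1, hz2, hJgen, hf1, hf2, hg1, hg2⟩ :=
    lci_alg I (Ideal.ofList a') hTI c x y f g p q hcI hxI hyI hfg hδ h1 h2 hgen1
  have hIP : ∀ (P : Ideal A) [P.IsPrime], J ≤ P → I ≤ P := by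
    intro P hP hJP z hz
    exact (or_self_iff.1 (hP.mem_or_mem (hJP (hIIJ (Ideal.mul_mem_mul hz hz)))))
  have hJ : ∀ (P : Ideal A) [P.IsPrime], J ≤ P → ∃ rs : List (Localization.AtPrime P),
      rs.length = n + 1 + 1 ∧ RingTheory.Sequence.IsRegular (Localization.AtPrime P) rs ∧
      Ideal.ofList rs = J.map (algebraMap A (Localization.AtPrime P)) := by
    intro P hP hJP
    have hP1 := hIP P hJP
    by_cases hf : f ∈ P
    · have hg : g ∉ P := by
        intro hg
        exact hP.ne_top ((Ideal.eq_top_iff_one _).2 (hfg ▸ add_mem hf hg))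
      exact lci_sq_at P I J hP1 _ (hI P hP1) hIIJ hJI a' k2 y (by omega) hTJ hk2 hyI g hg hg1 hg2
    · exact lci_sq_at P I J hP1 _ (hI P hP1) hIIJ hJI a' k0 c (by omega) hTJ hk0 hcI f hf hf1 hf2
  refine ⟨J, ?_, ⟨?_, hJ⟩, ?_⟩
  · apply le_antisymm
    · rw [← Ideal.radical_idem J]
      apply Ideal.radical_mono
      intro z hz
      exact ⟨2, by rw [pow_two]; exact hIIJ (Ideal.mul_mem_mul hz hz)⟩
    · exact Ideal.radical_mono hJI
  · rw [← hht]
    exact lci_height_congr J I fun P => ⟨fun h => hIP P.asIdeal h, fun h => hJI.trans h⟩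
  · have hap : Ideal.ofList (a' ++ [z1] ++ [z2]) =
        Ideal.ofList a' ⊔ Ideal.span {z1} ⊔ Ideal.span {z2} := by
      rw [Ideal.ofList_append, Ideal.ofList_append, Ideal.ofList_singleton, Ideal.ofList_singleton]
    refine lci_free I J _ hJ hIP hIIJ (a' ++ [z1] ++ [z2]) (by simp; omega) ?_ ?_
    · rw [hap]
      exact sup_le (sup_le hTJ ((Ideal.span_singleton_le_iff_mem _).2 hz1))
        ((Ideal.span_singleton_le_iff_mem _).2 hz2)
    · rw [hap]; exact hJgen
end

section
/- Let A be a commutative Noetherian ring and let J ⊂ A be a local complete intersection ideal of height 2. Suppose there is a short exact sequence 0 → A → P → J → 0 of A-modules in which P is a finitely generated projective A-module of rank 2 and the surjection g : P → J. Then the associated Koszul complex 0 → Λ²P → P → J → 0, with first map p ∧ q ↦ g(p)q − g(q)p and second map g, is exact; in particular the determinant Λ²P of P is isomorphic to A. -/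
universe u

theorem aux_ring {S : Type*} [CommRing S] [IsLocalRing S] (a b r₁ r₂ : S)
    (hreg : RingTheory.Sequence.IsRegular S [r₁, r₂])
    (hspan : Ideal.span {a, b} = Ideal.ofList [r₁, r₂]) :
    (∀ x y : S, x * a + y * b = 0 → ∃ t, x = -(t * b) ∧ y = t * a) ∧
    (∀ t : S, t * a = 0 → t * b = 0 → t = 0) := by
  have hof : Ideal.ofList [r₁, r₂] = Ideal.span {r₁, r₂} := by
    rw [Ideal.ofList_cons, Ideal.ofList_singleton, ← Ideal.span_union]; rfl
  have hne : Ideal.span {r₁, r₂} ≠ (⊤ : Ideal S) := by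
    intro h
    apply hreg.top_ne_smul
    rw [hof, h]; simp
  have hle := IsLocalRing.le_maximalIdeal hne
  have hr1 : r₁ ∈ IsLocalRing.maximalIdeal S := hle (Ideal.subset_span (by simp))
  have hr2 : r₂ ∈ IsLocalRing.maximalIdeal S := hle (Ideal.subset_span (by simp))
  have hw := hreg.toIsWeaklyRegular
  rw [RingTheory.Sequence.isWeaklyRegular_cons_iff] at hw
  obtain ⟨h1, h2⟩ := hw
  rw [RingTheory.Sequence.isWeaklyRegular_cons_iff] at h2
  have h2 := h2.1
  have nzd : ∀ t : S, t * r₁ = 0 → t = 0 := by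
    intro t ht
    apply h1
    simp only [smul_eq_mul]
    linear_combination ht
  have syz : ∀ x y : S, x * r₁ + y * r₂ = 0 → ∃ t, x = -(t * r₂) ∧ y = t * r₁ := by
    intro x y hxy
    have hq : (Submodule.Quotient.mk y : QuotSMulTop r₁ S) = 0 := by
      apply h2
      simp only [smul_zero]
      rw [← Submodule.Quotient.mk_smul, Submodule.Quotient.mk_eq_zero,
        Submodule.mem_smul_pointwise_iff_exists]
      refine ⟨-x, trivial, ?_⟩
      simp only [smul_eq_mul]
      linear_combination -hxy
    rw [Submodule.Quotient.mk_eq_zero, Submodule.mem_smul_pointwise_iff_exists] at hq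
    obtain ⟨t, -, ht⟩ := hq
    simp only [smul_eq_mul] at ht
    refine ⟨t, ?_, by linear_combination -ht⟩
    have := nzd (x + t * r₂) (by linear_combination hxy + r₂ * ht)
    linear_combination this
  rw [hof] at hspan
  have ha : a ∈ Ideal.span {r₁, r₂} := hspan ▸ Ideal.subset_span (by simp)
  have hb : b ∈ Ideal.span {r₁, r₂} := hspan ▸ Ideal.subset_span (by simp)
  have hr1' : r₁ ∈ Ideal.span {a, b} := hspan ▸ Ideal.subset_span (by simp)
  have hr2' : r₂ ∈ Ideal.span {a, b} := hspan ▸ Ideal.subset_span (by simp)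
  obtain ⟨n11, n12, ha⟩ := Ideal.mem_span_pair.1 ha
  obtain ⟨n21, n22, hb⟩ := Ideal.mem_span_pair.1 hb
  obtain ⟨m11, m12, hc⟩ := Ideal.mem_span_pair.1 hr1'
  obtain ⟨m21, m22, hd⟩ := Ideal.mem_span_pair.1 hr2'
  obtain ⟨t, e1, e2⟩ := syz (m11 * n11 + m12 * n21 - 1) (m11 * n12 + m12 * n22)
    (by linear_combination m11 * ha + m12 * hb + hc)
  obtain ⟨t', e3, e4⟩ := syz (m21 * n11 + m22 * n21) (m21 * n12 + m22 * n22 - 1)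
    (by linear_combination m21 * ha + m22 * hb + hd)
  have hu : IsUnit ((m11 * m22 - m12 * m21) * (n11 * n22 - n12 * n21)) := by
    have e : (m11 * m22 - m12 * m21) * (n11 * n22 - n12 * n21)
        = 1 - (t * r₂ - t' * r₁) := by
      linear_combination (m21 * n12 + m22 * n22) * e1 + (1 - t * r₂) * e4
        - (m21 * n11 + m22 * n21) * e2 - t * r₁ * e3
    rw [e]
    have hm : t * r₂ - t' * r₁ ∈ IsLocalRing.maximalIdeal S :=
      sub_mem (Ideal.mul_mem_left _ _ hr2) (Ideal.mul_mem_left _ _ hr1)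
    by_contra hcon
    have := add_mem ((IsLocalRing.mem_maximalIdeal _).2 hcon) hm
    rw [sub_add_cancel] at this
    exact (IsLocalRing.mem_maximalIdeal _).1 this isUnit_one
  obtain ⟨u, hu⟩ := (isUnit_of_mul_isUnit_right hu).exists_left_inv
  refine ⟨fun x y hxy => ?_, fun s hsa hsb => ?_⟩
  · obtain ⟨w, f1, f2⟩ := syz (x * n11 + y * n21) (x * n12 + y * n22)
      (by linear_combination hxy + x * ha + y * hb)
    refine ⟨u * w, ?_, ?_⟩
    · linear_combination (-x) * hu + u * n22 * f1 - u * n21 * f2 - u * w * hb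
    · linear_combination (-y) * hu + u * n11 * f2 - u * n12 * f1 + u * w * ha
  · exact nzd s (by linear_combination m11 * hsa + m12 * hsb - s * hc)

theorem aux_basis {A : Type*} [CommRing A] (m : Ideal A) [m.IsPrime]
    (P : Type*) [AddCommGroup P] [Module A P]
    (b : Module.Basis (Fin 2) (Localization.AtPrime m) (LocalizedModule m.primeCompl P)) :
    ∃ p q : P, (∀ x : P, ∃ s ∉ m, ∃ α β : A, s • x = α • p + β • q) ∧
      (∀ α β : A, α • p + β • q = 0 → ∃ s ∉ m, s * α = 0 ∧ s * β = 0) := by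
  let φ := LocalizedModule.mkLinearMap m.primeCompl P
  obtain ⟨⟨p, s⟩, hp⟩ := IsLocalizedModule.surj m.primeCompl φ (b 0)
  obtain ⟨⟨q, s'⟩, hq⟩ := IsLocalizedModule.surj m.primeCompl φ (b 1)
  simp only at hp hq
  have inj : ∀ x : P, φ x = 0 → ∃ s ∉ m, s • x = 0 := by
    intro x hx
    obtain ⟨c, hc⟩ := (IsLocalizedModule.eq_zero_iff m.primeCompl φ).1 hx
    exact ⟨c, c.2, hc⟩
  have injA : ∀ x : A, algebraMap A (Localization.AtPrime m) x = 0 → ∃ s ∉ m, s * x = 0 := by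
    intro x hx
    obtain ⟨c, hc⟩ := (IsLocalization.map_eq_zero_iff m.primeCompl _ x).1 hx
    exact ⟨c, c.2, hc⟩
  have mulne : ∀ {x y : A}, x ∉ m → y ∉ m → x * y ∉ m :=
    fun {x y} hx hy => m.primeCompl.mul_mem hx hy
  refine ⟨p, q, fun x => ?_, fun α β h => ?_⟩
  · have hx := b.sum_repr (φ x)
    rw [Fin.sum_univ_two] at hx
    obtain ⟨⟨c0, t0⟩, h0⟩ := IsLocalization.surj m.primeCompl (b.repr (φ x) 0)
    obtain ⟨⟨c1, t1⟩, h1⟩ := IsLocalization.surj m.primeCompl (b.repr (φ x) 1)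
    simp only at h0 h1
    have key : φ ((s * s' * t0 * t1 : A) • x - ((s' * t1 * c0 : A) • p + (s * t0 * c1 : A) • q)) = 0 := by
      rw [map_sub, map_add, map_smul, map_smul, map_smul, ← hp, ← hq, ← hx]
      simp only [Submonoid.smul_def, ← algebraMap_smul (Localization.AtPrime m) (_ : A)
        (_ : LocalizedModule m.primeCompl P), map_mul, ← h0, ← h1]
      simp only [smul_add, smul_smul]
      rw [sub_eq_zero]
      congr 2 <;> ring
    obtain ⟨c, hc, hc'⟩ := inj _ key
    refine ⟨c * (s * s' * t0 * t1), mulne hc (mulne (mulne (mulne s.2 s'.2) t0.2) t1.2),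
      c * (s' * t1 * c0), c * (s * t0 * c1), ?_⟩
    rw [smul_sub, sub_eq_zero, smul_add] at hc'
    simpa only [mul_smul] using hc'
  · have h' : φ (α • p + β • q) = 0 := by rw [h, map_zero]
    rw [map_add, map_smul, map_smul, ← hp, ← hq] at h'
    simp only [Submonoid.smul_def, ← algebraMap_smul (Localization.AtPrime m) (_ : A)
        (_ : LocalizedModule m.primeCompl P), smul_smul, ← map_mul] at h'
    have li := b.linearIndependent
    rw [Fintype.linearIndependent_iff] at li
    have := li ![algebraMap A _ (α * s), algebraMap A _ (β * s')] (by simpa [Fin.sum_univ_two] using h')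
    obtain ⟨c, hc, hc'⟩ := injA _ (this 0)
    obtain ⟨d, hd, hd'⟩ := injA _ (this 1)
    refine ⟨c * d * s * s', mulne (mulne (mulne hc hd) s.2) s'.2, ?_, ?_⟩
    · linear_combination d * s' * hc'
    · linear_combination c * s * hd'

theorem aux_koszul {A : Type*} [CommRing A] (m : Ideal A) [m.IsPrime] (J : Ideal A)
    (hJ : IsLocalCompleteIntersectionOfHeight J 2) (a b : A) (ha : a ∈ J) (hb : b ∈ J)
    (hgen : ∀ j ∈ J, ∃ s ∉ m, ∃ α β : A, s * j = α * a + β * b) :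
    (∀ x y : A, x * a + y * b = 0 → ∃ s ∉ m, ∃ t, s * x = -(t * b) ∧ s * y = t * a) ∧
    (∀ t : A, t * a = 0 → t * b = 0 → ∃ s ∉ m, s * t = 0) := by
  have mulne : ∀ {x y : A}, x ∉ m → y ∉ m → x * y ∉ m :=
    fun {x y} hx hy => m.primeCompl.mul_mem hx hy
  by_cases hm : J ≤ m
  · obtain ⟨rs, hl, hreg, hsp⟩ := hJ.2 m hm
    obtain ⟨r₁, r₂, rfl⟩ := List.length_eq_two.1 hl
    let ψ := algebraMap A (Localization.AtPrime m)
    have injA : ∀ x : A, ψ x = 0 → ∃ s ∉ m, s * x = 0 := by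
      intro x hx
      obtain ⟨c, hc⟩ := (IsLocalization.map_eq_zero_iff m.primeCompl _ x).1 hx
      exact ⟨c, c.2, hc⟩
    have hspan : Ideal.span {ψ a, ψ b} = Ideal.ofList [r₁, r₂] := by
      rw [hsp]
      apply le_antisymm
      · rw [Ideal.span_le]
        rintro _ (rfl | rfl)
        · exact Ideal.mem_map_of_mem _ ha
        · exact Ideal.mem_map_of_mem _ hb
      · rw [Ideal.map_le_iff_le_comap]
        intro j hj
        obtain ⟨s, hs, α, β, e⟩ := hgen j hj
        have e' := congrArg ψ e
        simp only [map_mul, map_add] at e'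
        have hu : IsUnit (ψ s) := IsLocalization.map_units (M := m.primeCompl) _ ⟨s, hs⟩
        rw [Ideal.mem_comap, ← Ideal.unit_mul_mem_iff_mem _ hu]
        change ψ s * ψ j ∈ _
        rw [e']
        exact Ideal.mem_span_pair.2 ⟨_, _, rfl⟩
    obtain ⟨k1, k2⟩ := aux_ring _ _ r₁ r₂ hreg hspan
    refine ⟨fun x y hxy => ?_, fun t h1 h2 => ?_⟩
    · obtain ⟨t, e1, e2⟩ := k1 (ψ x) (ψ y) (by rw [← map_mul, ← map_mul, ← map_add, hxy, map_zero])
      obtain ⟨⟨c, d⟩, h0⟩ := IsLocalization.surj m.primeCompl t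
      change t * ψ d = ψ c at h0
      obtain ⟨s1, hs1, f1⟩ := injA (d * x + c * b) (by
        simp only [map_mul, map_add, ← h0]; linear_combination ψ d * e1)
      obtain ⟨s2, hs2, f2⟩ := injA (d * y - c * a) (by
        simp only [map_mul, map_sub, ← h0]; linear_combination ψ d * e2)
      refine ⟨s1 * s2 * d, mulne (mulne hs1 hs2) d.2, s1 * s2 * c, ?_, ?_⟩
      · linear_combination s2 * f1
      · linear_combination s1 * f2
    · exact injA _ (k2 _ (by rw [← map_mul, h1, map_zero]) (by rw [← map_mul, h2, map_zero]))
  · obtain ⟨j, hj, hjm⟩ := Set.not_subset.1 hm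
    obtain ⟨s, hs, α, β, e⟩ := hgen j hj
    refine ⟨fun x y hxy => ⟨s * j, mulne hs hjm, α * y - β * x, ?_, ?_⟩,
      fun t h1 h2 => ⟨s * j, mulne hs hjm, ?_⟩⟩
    · linear_combination x * e + α * hxy
    · linear_combination y * e + β * hxy
    · linear_combination t * e + α * h1 + β * h2

theorem aux_local {A : Type*} [CommRing A] {M : Type*} [AddCommGroup M] [Module A M]
    (N : Submodule A M) (x : M)
    (h : ∀ m : Ideal A, m.IsPrime → ∃ s ∉ m, s • x ∈ N) : x ∈ N := by
  by_contra hx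
  have hne : N.colon {x} ≠ ⊤ := by
    intro ht
    have : (1 : A) ∈ N.colon {x} := by rw [ht]; trivial
    rw [Submodule.mem_colon_singleton] at this
    exact hx (by simpa using this)
  obtain ⟨m, hm, hle⟩ := Ideal.exists_le_maximal _ hne
  obtain ⟨s, hs, hsx⟩ := h m hm.isPrime
  exact hs (hle (Submodule.mem_colon_singleton.2 hsx))

/-- Given a short exact sequence `0 → A → P → J → 0` with `P` finitely generated
projective of rank `2` and `J` a local complete intersection ideal of height
`2`, the associated Koszul complex `0 → Λ²P → P → J → 0` (with first map
`p ∧ q ↦ g(p)q − g(q)p` and second map `g`) is exact; in particular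
`Λ²P ≅ A`. -/
theorem koszul_complex_of_ses_onto_lci_height_two_exact_and_det_trivial
    {A : Type u} [CommRing A] [IsNoetherianRing A]
    (J : Ideal A) (hJ : IsLocalCompleteIntersectionOfHeight J 2)
    (P : Type u) [AddCommGroup P] [Module A P]
    [Module.Projective A P] [Module.Finite A P]
    (hrank : ∀ (p : Ideal A) (_ : p.IsPrime),
      Nonempty (Module.Basis (Fin 2) (Localization.AtPrime p)
        (LocalizedModule p.primeCompl P)))
    (f : A →ₗ[A] P) (g : P →ₗ[A] A)
    (hf : Function.Injective f) (hfg : Function.Exact f g)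
    (hg : LinearMap.range g = (J : Submodule A A))
    (h : (⋀[A]^2 P) →ₗ[A] P)
    (hh : ∀ p q : P,
      h ⟨ExteriorAlgebra.ιMulti A 2 ![p, q],
          ExteriorAlgebra.ιMulti_range A 2 (Set.mem_range_self ![p, q])⟩ =
        g p • q - g q • p) :
    Function.Injective h ∧ Function.Exact h g ∧
      Nonempty ((⋀[A]^2 P) ≃ₗ[A] A) := by
  have hιs : ∀ p q : P, (⟨ExteriorAlgebra.ιMulti A 2 ![p, q],
      ExteriorAlgebra.ιMulti_range A 2 (Set.mem_range_self ![p, q])⟩ : ⋀[A]^2 P)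
      = exteriorPower.ιMulti A 2 ![p, q] := fun _ _ => rfl
  simp only [hιs] at hh
  have hgJ : ∀ x, g x ∈ J := fun x => by
    have : g x ∈ LinearMap.range g := ⟨x, rfl⟩
    rwa [hg] at this
  have loc : ∀ m : Ideal A, m.IsPrime → ∃ p q : P,
      (∀ x : P, ∃ s ∉ m, ∃ α β : A, s • x = α • p + β • q) ∧
      (∀ α β : A, α • p + β • q = 0 → ∃ s ∉ m, s * α = 0 ∧ s * β = 0) ∧
      (∀ x y : A, x * g p + y * g q = 0 →
        ∃ s ∉ m, ∃ t, s * x = -(t * g q) ∧ s * y = t * g p) ∧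
      (∀ t : A, t * g p = 0 → t * g q = 0 → ∃ s ∉ m, s * t = 0) := by
    intro m hm
    obtain ⟨b⟩ := hrank m hm
    obtain ⟨p, q, h1, h2⟩ := aux_basis m P b
    obtain ⟨h3, h4⟩ := aux_koszul m J hJ (g p) (g q) (hgJ p) (hgJ q) (by
      intro j hj
      have : j ∈ LinearMap.range g := by rw [hg]; exact hj
      obtain ⟨x, rfl⟩ := this
      obtain ⟨s, hs, α, β, e⟩ := h1 x
      refine ⟨s, hs, α, β, ?_⟩
      simpa using congrArg g e)
    exact ⟨p, q, h1, h2, h3, h4⟩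
  have hgh : ∀ w, g (h w) = 0 := by
    intro w
    have : g ∘ₗ h = 0 := by
      apply exteriorPower.linearMap_ext
      ext v
      have hv : v = ![v 0, v 1] := by ext i; fin_cases i <;> rfl
      rw [hv]
      simp only [LinearMap.compAlternatingMap_apply, LinearMap.comp_apply, hh, map_sub, map_smul,
        smul_eq_mul]
      simp [mul_comm]
    exact LinearMap.congr_fun this w
  have hinj : Function.Injective h := by
    rw [injective_iff_map_eq_zero]
    intro w hw
    rw [← Submodule.mem_bot A]
    apply aux_local
    intro m hm
    have mulne : ∀ {x y : A}, x ∉ m → y ∉ m → x * y ∉ m :=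
      fun {x y} hx hy => m.primeCompl.mul_mem hx hy
    obtain ⟨p, q, h1, h2, h3, h4⟩ := loc m hm
    have key : ∀ w : ⋀[A]^2 P, ∃ s ∉ m, ∃ c : A,
        s • w = c • exteriorPower.ιMulti A 2 ![p, q] := by
      intro w
      have hw : w ∈ Submodule.span A (Set.range (exteriorPower.ιMulti A 2 (M := P))) := by
        rw [exteriorPower.ιMulti_span]; trivial
      induction hw using Submodule.span_induction with
      | mem w hw =>
        obtain ⟨v, rfl⟩ := hw
        have hv : v = ![v 0, v 1] := by ext i; fin_cases i <;> rfl
        rw [hv]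
        obtain ⟨s, hs, α, β, e⟩ := h1 (v 0)
        obtain ⟨s', hs', α', β', e'⟩ := h1 (v 1)
        refine ⟨s * s', mulne hs hs', α * β' - β * α', ?_⟩
        have u0 : ∀ x y z : P, Function.update ![x, y] 0 z = ![z, y] := by
          intro x y z; ext i; fin_cases i <;> simp
        have u1 : ∀ x y z : P, Function.update ![x, y] 1 z = ![x, z] := by
          intro x y z; ext i; fin_cases i <;> simp
        let B : P →ₗ[A] P →ₗ[A] ⋀[A]^2 P := LinearMap.mk₂ A
          (fun x y => exteriorPower.ιMulti A 2 ![x, y])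
          (fun x y z => by
            have := (exteriorPower.ιMulti A 2 (M := P)).map_update_add ![0, z] 0 x y
            rwa [u0, u0, u0] at this)
          (fun c x z => by
            have := (exteriorPower.ιMulti A 2 (M := P)).map_update_smul ![0, z] 0 c x
            rwa [u0, u0] at this)
          (fun x y z => by
            have := (exteriorPower.ιMulti A 2 (M := P)).map_update_add ![x, 0] 1 y z
            rwa [u1, u1, u1] at this)
          (fun c x z => by
            have := (exteriorPower.ιMulti A 2 (M := P)).map_update_smul ![x, 0] 1 c z
            rwa [u1, u1] at this)
        have hB0 : ∀ x, B x x = 0 := fun x =>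
          (exteriorPower.ιMulti A 2 (M := P)).map_eq_zero_of_eq ![x, x]
            (i := 0) (j := 1) rfl (by decide)
        have hBs : ∀ x y, B y x = - B x y := fun x y => by
          have := hB0 (x + y)
          simp only [map_add, LinearMap.add_apply, hB0, zero_add, add_zero] at this
          exact eq_neg_of_add_eq_zero_left this
        change (s * s') • B (v 0) (v 1) = _ • B p q
        have : (s * s') • B (v 0) (v 1) = B (s • v 0) (s' • v 1) := by
          simp [mul_smul, smul_comm s s']
        rw [this, e, e']
        simp only [map_add, LinearMap.add_apply, map_smul, LinearMap.smul_apply, hB0, hBs p q]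
        module
      | zero => exact ⟨1, fun h => hm.ne_top ((Ideal.eq_top_iff_one _).2 h), 0, by simp⟩
      | add x y _ _ hx hy =>
        obtain ⟨s, hs, c, e⟩ := hx
        obtain ⟨s', hs', c', e'⟩ := hy
        refine ⟨s * s', mulne hs hs', s' * c + s * c', ?_⟩
        rw [smul_add, mul_comm s s', mul_smul, e, mul_comm s' s, mul_smul, e']
        module
      | smul a x _ hx =>
        obtain ⟨s, hs, c, e⟩ := hx
        exact ⟨s, hs, a * c, by rw [smul_comm, e, mul_smul]⟩
    obtain ⟨s, hs, c, e⟩ := key w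
    have e' := congrArg h e
    rw [map_smul, map_smul, hw, hh, smul_zero] at e'
    obtain ⟨d, hd, f1, f2⟩ := h2 (-(c * g q)) (c * g p) (by rw [e']; module)
    obtain ⟨u, hu, hu'⟩ := h4 (d * c) (by linear_combination f2) (by linear_combination -f1)
    refine ⟨u * d * s, mulne (mulne hu hd) hs, ?_⟩
    rw [Submodule.mem_bot, mul_smul, e, smul_smul, mul_assoc, hu', zero_smul]
  have hex : Function.Exact h g := by
    intro x
    refine ⟨fun hx => ?_, ?_⟩
    · change x ∈ LinearMap.range h
      apply aux_local
      intro m hm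
      have mulne : ∀ {x y : A}, x ∉ m → y ∉ m → x * y ∉ m :=
        fun {x y} hx hy => m.primeCompl.mul_mem hx hy
      obtain ⟨p, q, h1, h2, h3, h4⟩ := loc m hm
      obtain ⟨s, hs, α, β, e⟩ := h1 x
      have e' := congrArg g e
      simp only [map_add, map_smul, hx, smul_eq_mul, mul_zero] at e'
      obtain ⟨d, hd, t, f1, f2⟩ := h3 α β e'.symm
      refine ⟨d * s, mulne hd hs, t • exteriorPower.ιMulti A 2 ![p, q], ?_⟩
      rw [map_smul, hh, mul_smul, e, smul_add, smul_smul, smul_smul, f1, f2]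
      module
    · rintro ⟨w, rfl⟩
      exact hgh w
  refine ⟨hinj, hex, ⟨(LinearEquiv.ofInjective h hinj).trans
    ((LinearEquiv.ofEq _ _ ?_).trans (LinearEquiv.ofInjective f hf).symm)⟩⟩
  rw [← LinearMap.exact_iff.1 hex, LinearMap.exact_iff.1 hfg]
end
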